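/- Let w₁ < w₂ < ⋯ < w_k be real numbers, let Λ₁,…,Λ_k be partitions of n with Σᵢ(n − l(Λᵢ)) = n − 1, and let 1 ≤ i ≤ k − 1. Then the s-number Σ_{P∈S_{Λ₁,…,Λ_{i−1},Λᵢ,Λ_{i+1},Λ_{i+2},…,Λ_k}(w₁,…,w_k)} ε(P) equals the s-number Σ_{P∈S_{Λ₁,…,Λ_{i−1},Λ_{i+1},Λᵢ,Λ_{i+2},…,Λ_k}(w₁,…,w_k)} ε(P) obtained by transposing the partitions Λᵢ and Λ_{i+1} assigned to the consecutive branch points wᵢ and w_{i+1}. -/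

import Mathlib

open Polynomial
open scoped Classical

/-- The ramification type of `w` for a real polynomial `P`: the multiset of
multiplicities of the complex roots of `P - w`. -/
noncomputable def ramType (P : Polynomial ℝ) (w : ℝ) : Multiset ℕ :=
  ((P.map (algebraMap ℝ ℂ) - Polynomial.C (w : ℂ)).roots.toFinset.val).map
    fun z => (P.map (algebraMap ℝ ℂ) - Polynomial.C (w : ℂ)).rootMultiplicity z

/-- A disorder of `P`: a pair `x₁ < x₂` with `P x₁ = P x₂` and the multiplicity of `x₁`
as a root of `P - P x₁` strictly greater than that of `x₂`. -/
def disorders (P : Polynomial ℝ) : Set (ℝ × ℝ) :=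
  {p | p.1 < p.2 ∧ P.eval p.1 = P.eval p.2 ∧
    (P - Polynomial.C (P.eval p.2)).rootMultiplicity p.2
      < (P - Polynomial.C (P.eval p.1)).rootMultiplicity p.1}

/-- The sign `ε(P) = (-1)^{number of disorders}`. -/
noncomputable def epsilonP (P : Polynomial ℝ) : ℤ := (-1) ^ Nat.card (disorders P)

/-- `P = X^n + a₂ X^(n-2) + ⋯ + a_n`: monic of degree `n` with vanishing coefficient
of `X^(n-1)`. -/
def IsNormalized (n : ℕ) (P : Polynomial ℝ) : Prop :=
  P.natDegree = n ∧ P.Monic ∧ P.coeff (n - 1) = 0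

/-- A multiset of positive integers summing to `n`. -/
def IsPartitionOf (n : ℕ) (Λ : Multiset ℕ) : Prop := Λ.sum = n ∧ 0 ∉ Λ

/-- The set `S_{Λ₁,…,Λ_k}(w₁,…,w_k)` of normalized real polynomials of degree `n` with
ramification type `Λ i` at `w i` for every `i`. -/
noncomputable def sSet (n : ℕ) {k : ℕ} (Λ : Fin k → Multiset ℕ) (w : Fin k → ℝ) :
    Set (Polynomial ℝ) :=
  {P | IsNormalized n P ∧ ∀ i, ramType P (w i) = Λ i}

section Piola

variable {ι : Type*} [Fintype ι]

lemma contDiff_det_family {E : Type*} [NormedAddCommGroup E] [NormedSpace ℝ E]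
    {N : WithTop ℕ∞} (A : E → Matrix ι ι ℝ) (hA : ∀ i j, ContDiff ℝ N fun x => A x i j) :
    ContDiff ℝ N fun x => (A x).det := by
  simp only [Matrix.det_apply]
  refine ContDiff.sum fun σ _ => ?_
  exact (contDiff_prod fun i _ => hA _ _).const_smul _

lemma contDiff_adjugate_family {E : Type*} [NormedAddCommGroup E] [NormedSpace ℝ E]
    {N : WithTop ℕ∞} (A : E → Matrix ι ι ℝ) (hA : ∀ i j, ContDiff ℝ N fun x => A x i j)
    (i j : ι) :
    ContDiff ℝ N fun x => (A x).adjugate i j := by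
  simp only [Matrix.adjugate_apply]
  refine contDiff_det_family _ fun a b => ?_
  by_cases h : a = j
  · subst h; simpa using contDiff_const
  · simpa [Matrix.updateRow_apply, h] using hA a b

lemma deriv_det_line (A B : Matrix ι ι ℝ) (hA : A.det ≠ 0) :
    HasDerivAt (fun t : ℝ => (A + t • B).det) (A.det * (A⁻¹ * B).trace) 0 := by
  have hu : IsUnit A.det := isUnit_iff_ne_zero.2 hA
  have h : ∀ t : ℝ, (A + t • B).det = A.det * (1 + (A⁻¹ * B).trace * t +
      (((1 + (X : ℝ[X]) • (A⁻¹ * B).map C).det.divX.divX.eval t) * t ^ 2)) := fun t => by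
    rw [← Matrix.det_one_add_smul, ← Matrix.det_mul, mul_add, mul_one, Matrix.mul_smul,
      Matrix.mul_nonsing_inv_cancel_left _ _ hu]
  simp only [h]
  set q := (1 + (X : ℝ[X]) • (A⁻¹ * B).map C).det.divX.divX
  have := ((((hasDerivAt_id (0:ℝ)).const_mul (A⁻¹ * B).trace).const_add 1).add
    ((q.hasDerivAt 0).mul ((hasDerivAt_id (0:ℝ)).pow 2))).const_mul A.det
  simpa using this

lemma deriv_adjugate_line (A B : Matrix ι ι ℝ) (hA : A.det ≠ 0) (i j : ι) :
    HasDerivAt (fun t : ℝ => (A + t • B).adjugate i j)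
      (A.det * ((A⁻¹ * B).trace * A⁻¹ i j - (A⁻¹ * B * A⁻¹) i j)) 0 := by
  have hu : IsUnit A.det := isUnit_iff_ne_zero.2 hA
  have hd : ∀ i j, DifferentiableAt ℝ (fun t : ℝ => (A + t • B).adjugate i j) 0 := fun i j =>
    ((contDiff_adjugate_family (N := 1) (fun t : ℝ => A + t • B) (fun a b => by
      simp only [Matrix.add_apply, Matrix.smul_apply]; fun_prop) i j).differentiable
        (by norm_num)) 0
  set D : Matrix ι ι ℝ := fun i j => deriv (fun t : ℝ => (A + t • B).adjugate i j) 0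
  have key : B * A.adjugate + A * D = (A.det * (A⁻¹ * B).trace) • (1 : Matrix ι ι ℝ) := by
    ext a b
    have h1 : HasDerivAt (fun t : ℝ => ((A + t • B) * (A + t • B).adjugate) a b)
        ((B * A.adjugate + A * D) a b) 0 := by
      simp only [Matrix.mul_apply, Matrix.add_apply, ← Finset.sum_add_distrib]
      refine HasDerivAt.fun_sum fun c _ => ?_
      have h2 : HasDerivAt (fun t : ℝ => (A + t • B) a c) (B a c) 0 := by
        simpa using ((hasDerivAt_id (0:ℝ)).mul_const (B a c)).const_add (A a c)
      simpa using h2.fun_mul (hd c b).hasDerivAt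
    have h3 : HasDerivAt (fun t : ℝ => ((A + t • B) * (A + t • B).adjugate) a b)
        (((A.det * (A⁻¹ * B).trace) • (1 : Matrix ι ι ℝ)) a b) 0 := by
      simp only [Matrix.mul_adjugate, Matrix.smul_apply, smul_eq_mul]
      exact (deriv_det_line A B hA).mul_const _
    exact h1.unique h3
  have hD : D = A.det • ((A⁻¹ * B).trace • A⁻¹ - A⁻¹ * B * A⁻¹) := by
    have h4 : A * D = (A.det * (A⁻¹ * B).trace) • (1 : Matrix ι ι ℝ) - B * A.adjugate :=
      eq_sub_of_add_eq' key
    have h5 : D = A⁻¹ * (A * D) := (Matrix.nonsing_inv_mul_cancel_left _ _ hu).symm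
    have h6 : A.adjugate = A.det • A⁻¹ := by
      rw [Matrix.inv_def, smul_smul, Ring.mul_inverse_cancel _ hu, one_smul]
    rw [h5, h4, h6]
    simp [mul_sub, smul_sub, smul_smul, Matrix.mul_assoc]
  have h7 : HasDerivAt (fun t : ℝ => (A + t • B).adjugate i j) (D i j) 0 := (hd i j).hasDerivAt
  rw [hD] at h7
  simpa using h7

/-- The entry `(i, j)` of the adjugate as a function on the normed space `ι → ι → ℝ`. -/
noncomputable def adjEntry (i j : ι) (A : ι → ι → ℝ) : ℝ := (Matrix.of A).adjugate i j

lemma contDiff_adjEntry {N : WithTop ℕ∞} (i j : ι) : ContDiff ℝ N (adjEntry i j) :=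
  contDiff_adjugate_family (fun A : ι → ι → ℝ => Matrix.of A)
    (fun a b => by simp only [Matrix.of_apply]; fun_prop) i j

lemma fderiv_adjEntry (i j : ι) (A B : ι → ι → ℝ) (hA : (Matrix.of A).det ≠ 0) :
    fderiv ℝ (adjEntry i j) A B = (Matrix.of A).det * (((Matrix.of A)⁻¹ * Matrix.of B).trace *
      (Matrix.of A)⁻¹ i j - ((Matrix.of A)⁻¹ * Matrix.of B * (Matrix.of A)⁻¹) i j) := by
  have h1 := deriv_adjugate_line (Matrix.of A) (Matrix.of B) hA i j
  have h2 : HasDerivAt (fun t : ℝ => A + t • B) B 0 := by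
    simpa using ((hasDerivAt_id (0:ℝ)).smul_const B).const_add A
  have h3 : HasFDerivAt (adjEntry i j) (fderiv ℝ (adjEntry i j) A) (A + (0:ℝ) • B) := by
    rw [zero_smul, add_zero]
    exact ((contDiff_adjEntry (N := 1) i j).differentiable (by norm_num) A).hasFDerivAt
  exact HasDerivAt.unique (f := fun t : ℝ => adjEntry i j (A + t • B))
    (HasFDerivAt.comp_hasDerivAt (f := fun t : ℝ => A + t • B) (0 : ℝ) h3 h2) h1

lemma sum_fderiv_adjEntry_of_det_ne_zero (A : ι → ι → ℝ) (H : ι → ι → ι → ℝ)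
    (hH : ∀ i a b, H i a b = H b a i) (j : ι) (hA : (Matrix.of A).det ≠ 0) :
    ∑ i, fderiv ℝ (adjEntry i j) A (H i) = 0 := by
  simp only [fderiv_adjEntry _ _ _ _ hA, ← Finset.mul_sum, Finset.sum_sub_distrib]
  rw [sub_eq_zero.2, mul_zero]
  simp only [Matrix.trace, Matrix.diag, Matrix.mul_apply, Matrix.of_apply, Finset.sum_mul]
  rw [Finset.sum_comm]
  refine Finset.sum_congr rfl fun b _ => ?_
  refine Finset.sum_congr rfl fun i _ => Finset.sum_congr rfl fun a _ => ?_
  rw [hH]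

/-- The Piola identity at the level of matrices. -/
lemma sum_fderiv_adjEntry (A : ι → ι → ℝ) (H : ι → ι → ι → ℝ)
    (hH : ∀ i a b, H i a b = H b a i) (j : ι) :
    ∑ i, fderiv ℝ (adjEntry i j) A (H i) = 0 := by
  let P : ℝ → ι → ι → ℝ := fun s a b => A a b + s * (1 : Matrix ι ι ℝ) a b
  have hc : Continuous fun s => ∑ i, fderiv ℝ (adjEntry i j) (P s) (H i) := by
    refine continuous_finsetSum _ fun i _ => ?_
    have h1 : Continuous (fderiv ℝ (adjEntry i j)) :=
      (contDiff_adjEntry (N := 1) i j).continuous_fderiv (by norm_num)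
    have h2 : Continuous P := by
      refine continuous_pi fun a => continuous_pi fun b => ?_
      fun_prop
    exact (h1.comp h2).clm_apply continuous_const
  have hne : ∀ᶠ s in nhdsWithin (0:ℝ) {0}ᶜ, (Matrix.of (P s)).det ≠ 0 := by
    have hfin : {s : ℝ | (Matrix.of (P s)).det = 0}.Finite := by
      refine ((-(Matrix.of A)).charpoly.roots.toFinset.finite_toSet).subset fun s hs => ?_
      rw [Finset.mem_coe, Multiset.mem_toFinset, mem_roots (Matrix.charpoly_monic _).ne_zero,
        IsRoot.def, Matrix.eval_charpoly]
      rw [← hs]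
      congr 1
      ext a b
      simp [P, Matrix.scalar_apply, Matrix.diagonal_apply, Matrix.one_apply]
      ring
    have h2 := (hfin.subset (Set.sdiff_subset (t := {0}))).isClosed.isOpen_compl.mem_nhds
      (x := (0:ℝ)) (by simp)
    filter_upwards [nhdsWithin_le_nhds h2, self_mem_nhdsWithin] with s hs hs0 h
    exact hs ⟨h, hs0⟩
  have h0 : (fun s => ∑ i, fderiv ℝ (adjEntry i j) (P s) (H i)) =ᶠ[nhdsWithin (0:ℝ) {0}ᶜ]
      fun _ => 0 := by
    filter_upwards [hne] with s hs
    exact sum_fderiv_adjEntry_of_det_ne_zero _ _ hH j hs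
  have h1 := (hc.tendsto 0).mono_left (nhdsWithin_le_nhds (s := {0}ᶜ))
  have h2 := tendsto_nhds_unique (h1.congr' h0) tendsto_const_nhds
  simpa [P] using h2

end Piola

section DegreeIntegral

open MeasureTheory Filter Topology
open scoped ContDiff

variable {ι : Type*} [Fintype ι]

/-- The Jacobian matrix of `f`. -/
noncomputable def jacMatrix (f : (ι → ℝ) → (ι → ℝ)) (x : ι → ℝ) : ι → ι → ℝ :=
  fun a b => fderiv ℝ f x (Pi.single b 1) a

lemma det_jacMatrix (f : (ι → ℝ) → (ι → ℝ)) (x : ι → ℝ) :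
    (Matrix.of (jacMatrix f x)).det = (fderiv ℝ f x).det := by
  rw [ContinuousLinearMap.det, ← LinearMap.det_toMatrix']
  congr 1

lemma contDiff_jacMatrix {f : (ι → ℝ) → (ι → ℝ)} (hf : ContDiff ℝ ∞ f) :
    ContDiff ℝ ∞ (jacMatrix f) := by
  rw [contDiff_pi]; intro a
  rw [contDiff_pi]; intro b
  have h1 : ContDiff ℝ ∞ (fderiv ℝ f) := hf.fderiv_right (by simp)
  exact contDiff_pi.1 (h1.clm_apply contDiff_const) a

lemma fderiv_jacMatrix {f : (ι → ℝ) → (ι → ℝ)} (hf : ContDiff ℝ ∞ f) (x u : ι → ℝ) (a b : ι) :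
    fderiv ℝ (jacMatrix f) x u a b = fderiv ℝ (fderiv ℝ f) x u (Pi.single b 1) a := by
  have h1 : DifferentiableAt ℝ (fderiv ℝ f) x :=
    (hf.fderiv_right (m := 1) (by norm_cast)).differentiable (by norm_num) x
  have h2 : DifferentiableAt ℝ (jacMatrix f) x :=
    (contDiff_jacMatrix hf).differentiable (by simp) x
  have h3 := h2.hasFDerivAt
  have h4 := (hasFDerivAt_pi'.1 (hasFDerivAt_pi'.1 h3 a) b)
  have h5 := hasFDerivAt_pi'.1 (h1.hasFDerivAt.clm_apply
    (hasFDerivAt_const (Pi.single b (1:ℝ) : ι → ℝ) x)) a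
  have := DFunLike.congr_fun (h4.unique h5) u
  simpa using this

lemma divergence_adjugate {f : (ι → ℝ) → (ι → ℝ)} (hf : ContDiff ℝ ∞ f) (x : ι → ℝ) (j : ι) :
    ∑ i, fderiv ℝ (fun x => adjEntry i j (jacMatrix f x)) x (Pi.single i 1) = 0 := by
  have h2 : DifferentiableAt ℝ (jacMatrix f) x :=
    (contDiff_jacMatrix hf).differentiable (by simp) x
  have h : ∀ i, fderiv ℝ (fun x => adjEntry i j (jacMatrix f x)) x (Pi.single i 1) =
      fderiv ℝ (adjEntry i j) (jacMatrix f x) (fderiv ℝ (jacMatrix f) x (Pi.single i 1)) := by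
    intro i
    have h3 := ((contDiff_adjEntry (N := 1) i j).differentiable (by norm_num) (jacMatrix f x))
    rw [show (fun x => adjEntry i j (jacMatrix f x)) = adjEntry i j ∘ jacMatrix f from rfl,
      fderiv_comp x h3 h2]
    rfl
  simp only [h]
  refine sum_fderiv_adjEntry _ _ (fun i a b => ?_) j
  rw [fderiv_jacMatrix hf, fderiv_jacMatrix hf]
  have := (hf.contDiffAt (x := x)).isSymmSndFDerivAt
    (by simpa using (by norm_cast : (2 : WithTop ℕ∞) ≤ ∞))
  rw [this.eq]

lemma integral_fderiv_mul_det_eq_zero {f : (ι → ℝ) → (ι → ℝ)} (hf : ContDiff ℝ ∞ f)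
    (hp : Tendsto f (cocompact _) (cocompact _)) {φ : (ι → ℝ) → ℝ} (hφ : ContDiff ℝ ∞ φ)
    (hc : HasCompactSupport φ) (v : ι → ℝ) :
    ∫ x, fderiv ℝ φ (f x) v * (fderiv ℝ f x).det = 0 := by
  set h : (ι → ℝ) → ℝ := fun x => φ (f x) with hh
  have hh1 : ContDiff ℝ ∞ h := hφ.comp hf
  have hhc : HasCompactSupport h := by
    refine HasCompactSupport.intro (K := f ⁻¹' tsupport φ) ?_ fun x hx => ?_
    · exact (isProperMap_iff_tendsto_cocompact.2 ⟨hf.continuous, hp⟩).isCompact_preimage hc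
    · exact image_eq_zero_of_notMem_tsupport (f := φ) hx
  have hX : ∀ i j, ContDiff ℝ ∞ fun x => adjEntry i j (jacMatrix f x) := fun i j =>
    (contDiff_adjEntry i j).comp (contDiff_jacMatrix hf)
  have hder : ∀ i, Continuous fun x => fderiv ℝ h x (Pi.single i 1) := fun i =>
    (hh1.continuous_fderiv (by simp)).clm_apply continuous_const
  have hderc : ∀ i, HasCompactSupport fun x => fderiv ℝ h x (Pi.single i 1) := fun i =>
    hhc.fderiv_apply ℝ _
  have hXder : ∀ i j, Continuous fun x =>
      fderiv ℝ (fun x => adjEntry i j (jacMatrix f x)) x (Pi.single i 1) := fun i j =>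
    ((hX i j).continuous_fderiv (by simp)).clm_apply continuous_const
  have hint1 : ∀ i j, Integrable fun x =>
      adjEntry i j (jacMatrix f x) * fderiv ℝ h x (Pi.single i 1) := fun i j =>
    ((hX i j).continuous.mul (hder i)).integrable_of_hasCompactSupport (hderc i).mul_left
  have hint2 : ∀ i j, Integrable fun x =>
      fderiv ℝ (fun x => adjEntry i j (jacMatrix f x)) x (Pi.single i 1) * h x := fun i j =>
    ((hXder i j).mul hh1.continuous).integrable_of_hasCompactSupport hhc.mul_left
  have hpt : ∀ x, fderiv ℝ φ (f x) v * (fderiv ℝ f x).det =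
      ∑ j, v j * ∑ i, adjEntry i j (jacMatrix f x) * fderiv ℝ h x (Pi.single i 1) := by
    intro x
    have e1 : ∀ w, fderiv ℝ h x w = fderiv ℝ φ (f x) (fderiv ℝ f x w) := fun w => by
      rw [show h = φ ∘ f from rfl, fderiv_comp x (hφ.differentiable (by simp) _)
        (hf.differentiable (by simp) _)]
      rfl
    have e2 : ∀ i, fderiv ℝ φ (f x) (fderiv ℝ f x (Pi.single i 1)) =
        ∑ a, jacMatrix f x a i * fderiv ℝ φ (f x) (Pi.single a 1) := fun i => by
      conv_lhs => rw [pi_eq_sum_univ' (fderiv ℝ f x (Pi.single i 1)), map_sum]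
      refine Finset.sum_congr rfl fun a _ => ?_
      rw [map_smul, smul_eq_mul]
      congr 2
    have e3 : ∀ a j, ∑ i, jacMatrix f x a i * adjEntry i j (jacMatrix f x) =
        (fderiv ℝ f x).det * (1 : Matrix ι ι ℝ) a j := fun a j => by
      have := congrFun (congrFun (Matrix.mul_adjugate (Matrix.of (jacMatrix f x))) a) j
      rw [det_jacMatrix] at this
      simpa [Matrix.mul_apply, adjEntry] using this
    simp only [e1, e2, Finset.mul_sum]
    calc _ = ∑ j, v j * ((fderiv ℝ f x).det * fderiv ℝ φ (f x) (Pi.single j 1)) := by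
            conv_lhs => rw [pi_eq_sum_univ' v, map_sum, Finset.sum_mul]
            refine Finset.sum_congr rfl fun a _ => ?_
            rw [map_smul, smul_eq_mul]
            ring
      _ = ∑ j, v j * ∑ a, (∑ i, jacMatrix f x a i * adjEntry i j (jacMatrix f x)) *
            fderiv ℝ φ (f x) (Pi.single a 1) := by
            refine Finset.sum_congr rfl fun j _ => ?_
            simp only [e3]
            congr 1
            rw [Finset.sum_eq_single j]
            · simp
            · intro b _ hb; simp [hb]
            · simp
      _ = _ := by
            refine Finset.sum_congr rfl fun j _ => ?_
            simp only [Finset.sum_mul, Finset.mul_sum]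
            rw [Finset.sum_comm]
            refine Finset.sum_congr rfl fun i _ => Finset.sum_congr rfl fun a _ => ?_
            ring
  simp only [hpt]
  rw [integral_finsetSum _ fun j _ => (integrable_finsetSum _ fun i _ => hint1 i j).const_mul _]
  refine Finset.sum_eq_zero fun j _ => ?_
  rw [integral_const_mul, integral_finsetSum _ fun i _ => hint1 i j]
  have ibp : ∀ i, ∫ x, adjEntry i j (jacMatrix f x) * fderiv ℝ h x (Pi.single i 1) =
      -∫ x, fderiv ℝ (fun x => adjEntry i j (jacMatrix f x)) x (Pi.single i 1) * h x := fun i =>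
    integral_mul_fderiv_eq_neg_fderiv_mul_of_integrable (hint2 i j) (hint1 i j)
      (((hX i j).continuous.mul hh1.continuous).integrable_of_hasCompactSupport hhc.mul_left)
      (fun x _ => (hX i j).differentiable (by simp) x) (fun x _ => hh1.differentiable (by simp) x)
  simp only [ibp, Finset.sum_neg_distrib]
  rw [← integral_finsetSum _ fun i _ => hint2 i j]
  simp only [← Finset.sum_mul, divergence_adjugate hf]
  simp

end DegreeIntegral

section DegreeInvariance

open MeasureTheory Filter Topology
open scoped ContDiff

variable {ι : Type*} [Fintype ι]

lemma integral_comp_mul_det_eq {f : (ι → ℝ) → (ι → ℝ)} (hf : ContDiff ℝ ∞ f)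
    (hp : Tendsto f (cocompact _) (cocompact _)) {φ : (ι → ℝ) → ℝ} (hφ : ContDiff ℝ ∞ φ)
    (hc : HasCompactSupport φ) (y₀ y₁ : ι → ℝ) :
    ∫ x, φ (f x - y₀) * (fderiv ℝ f x).det = ∫ x, φ (f x - y₁) * (fderiv ℝ f x).det := by
  set v := y₁ - y₀ with hv
  set F : ℝ → (ι → ℝ) → ℝ := fun t x => φ (f x - (y₀ + t • v)) * (fderiv ℝ f x).det with hF
  set F' : ℝ → (ι → ℝ) → ℝ := fun t x =>
    -(fderiv ℝ φ (f x - (y₀ + t • v)) v * (fderiv ℝ f x).det) with hF'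
  have hdet : Continuous fun x => (fderiv ℝ f x).det :=
    ContinuousLinearMap.continuous_det.comp (hf.continuous_fderiv (by simp))
  have hproper := isProperMap_iff_tendsto_cocompact.2 ⟨hf.continuous, hp⟩
  have hFc : ∀ t, Continuous (F t) := fun t =>
    (hφ.continuous.comp (hf.continuous.sub continuous_const)).mul hdet
  have hF'c : Continuous fun p : ℝ × (ι → ℝ) => F' p.1 p.2 := by
    refine Continuous.neg (Continuous.mul ?_ (hdet.comp continuous_snd))
    refine Continuous.clm_apply ?_ continuous_const
    refine (hφ.continuous_fderiv (by simp)).comp ?_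
    exact (hf.continuous.comp continuous_snd).sub (by fun_prop)
  have hder : ∀ t x, HasDerivAt (fun s => F s x) (F' t x) t := by
    intro t x
    have h1 : HasDerivAt (fun s : ℝ => f x - (y₀ + s • v)) (-v) t := by
      simpa using (((hasDerivAt_id t).smul_const v).const_add y₀).const_sub (f x)
    have h2 := (hφ.differentiable (by simp) (f x - (y₀ + t • v))).hasFDerivAt
    have h3 := (HasFDerivAt.comp_hasDerivAt (f := fun s : ℝ => f x - (y₀ + s • v)) t h2 h1).mul_const
      (fderiv ℝ f x).det
    simpa [hF', hF] using h3
  have hzero : ∀ t, ∫ x, F' t x = 0 := by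
    intro t
    have hf2 : ContDiff ℝ ∞ fun x => f x - (y₀ + t • v) := hf.sub contDiff_const
    have hp2 : Tendsto (fun x => f x - (y₀ + t • v)) (cocompact _) (cocompact _) :=
      (Homeomorph.subRight (y₀ + t • v)).isClosedEmbedding.tendsto_cocompact.comp hp
    have := integral_fderiv_mul_det_eq_zero hf2 hp2 hφ hc v
    simp only [fderiv_sub_const] at this
    simp only [hF', integral_neg, this, neg_zero]
  have hK : ∀ T : ℝ, ∃ K : Set (ι → ℝ), IsCompact K ∧
      ∀ t ∈ Metric.ball (0:ℝ) T, ∀ x, x ∉ K → F t x = 0 ∧ F' t x = 0 := by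
    intro T
    let L : Set (ι → ℝ) := (fun p : ℝ × (ι → ℝ) => p.2 + (y₀ + p.1 • v)) ''
      (Metric.closedBall (0:ℝ) T ×ˢ tsupport φ)
    have hL : IsCompact L := ((isCompact_closedBall _ _).prod hc).image (by fun_prop)
    refine ⟨f ⁻¹' L, hproper.isCompact_preimage hL, fun t ht x hx => ?_⟩
    have h1 : f x - (y₀ + t • v) ∉ tsupport φ := fun h =>
      hx ⟨(t, f x - (y₀ + t • v)), ⟨Metric.ball_subset_closedBall ht, h⟩, by simp⟩
    have h2 : fderiv ℝ φ (f x - (y₀ + t • v)) = 0 :=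
      image_eq_zero_of_notMem_tsupport (f := fderiv ℝ φ) fun h => h1 (tsupport_fderiv_subset ℝ h)
    constructor
    · simp [hF, image_eq_zero_of_notMem_tsupport h1]
    · simp [hF', h2]
  have hFint : ∀ t, Integrable (F t) := by
    intro t
    obtain ⟨K, hKc, hK⟩ := hK (|t| + 1)
    exact (hFc t).integrable_of_hasCompactSupport
      (HasCompactSupport.intro hKc fun x hx => (hK t (by simp) x hx).1)
  have hderI : ∀ t, HasDerivAt (fun s => ∫ x, F s x) 0 t := by
    intro t
    obtain ⟨K, hKc, hK⟩ := hK (|t| + 1)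
    obtain ⟨B, hB⟩ := ((isCompact_closedBall (0:ℝ) (|t| + 1)).prod hKc).exists_bound_of_continuousOn
      hF'c.continuousOn
    rw [← hzero t]
    refine (hasDerivAt_integral_of_dominated_loc_of_deriv_le
      (bound := K.indicator fun _ => B)
      (s := Metric.ball 0 (|t| + 1)) (Metric.isOpen_ball.mem_nhds (by simp))
      (Eventually.of_forall fun s => (hFc s).aestronglyMeasurable) (hFint t)
      (hF'c.comp (by fun_prop : Continuous fun x : ι → ℝ => (t, x))).aestronglyMeasurable
      (Eventually.of_forall fun x s hs => ?_) ?_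
      (Eventually.of_forall fun x s hs => hder s x)).2
    · by_cases hx : x ∈ K
      · rw [Set.indicator_of_mem hx]
        exact hB (s, x) ⟨Metric.ball_subset_closedBall hs, hx⟩
      · rw [Set.indicator_of_notMem hx, (hK s hs x hx).2, norm_zero]
    · rw [integrable_indicator_iff hKc.measurableSet]
      exact integrableOn_const hKc.measure_ne_top
  have := is_const_of_deriv_eq_zero (fun t => (hderI t).differentiableAt)
    (fun t => (hderI t).deriv) 0 1
  simpa [hF, hv] using this

end DegreeInvariance

section LocalDegree

open MeasureTheory Filter Topology
open scoped ContDiff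

variable {ι : Type*} [Fintype ι]

/-- Around a regular point a smooth map is injective with Jacobian of constant sign. -/
lemma exists_injOn_sign_const {f : (ι → ℝ) → (ι → ℝ)} (hf : ContDiff ℝ ∞ f) {x : ι → ℝ}
    (hx : (fderiv ℝ f x).det ≠ 0) :
    (∃ U : Set (ι → ℝ), IsOpen U ∧ x ∈ U ∧ U.InjOn f ∧
      ∀ z ∈ U, SignType.sign (fderiv ℝ f z).det = SignType.sign (fderiv ℝ f x).det) ∧
      map f (𝓝 x) = 𝓝 (f x) := by
  have h1 : HasStrictFDerivAt f
      (((fderiv ℝ f x).toContinuousLinearEquivOfDetNeZero hx : (ι → ℝ) ≃L[ℝ] (ι → ℝ)) :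
        (ι → ℝ) →L[ℝ] (ι → ℝ)) x := by
    rw [ContinuousLinearMap.coe_toContinuousLinearEquivOfDetNeZero]
    exact hf.contDiffAt.hasStrictFDerivAt (by simp)
  refine ⟨?_, h1.map_nhds_eq_of_equiv⟩
  have hdet : Continuous fun x => (fderiv ℝ f x).det :=
    ContinuousLinearMap.continuous_det.comp (hf.continuous_fderiv (by simp))
  have h2 : ∀ᶠ z in 𝓝 x, SignType.sign (fderiv ℝ f z).det = SignType.sign (fderiv ℝ f x).det := by
    have := (continuousAt_sign_of_ne_zero hx).comp (f := fun x => (fderiv ℝ f x).det)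
      hdet.continuousAt
    exact this.eventually (by simp : ∀ᶠ s in 𝓝 (SignType.sign (fderiv ℝ f x).det),
      s = SignType.sign (fderiv ℝ f x).det)
  obtain ⟨U, hU, hUo, hxU⟩ := eventually_nhds_iff.1 h2
  refine ⟨U ∩ (h1.toOpenPartialHomeomorph f).source,
    hUo.inter (h1.toOpenPartialHomeomorph f).open_source,
    ⟨hxU, h1.mem_toOpenPartialHomeomorph_source⟩, ?_, fun z hz => hU z hz.1⟩
  have := (h1.toOpenPartialHomeomorph f).injOn
  rw [h1.toOpenPartialHomeomorph_coe] at this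
  exact this.mono Set.inter_subset_right

lemma finite_preimage_of_regular {f : (ι → ℝ) → (ι → ℝ)} (hf : ContDiff ℝ ∞ f)
    (hp : Tendsto f (cocompact _) (cocompact _)) (y : ι → ℝ)
    (hreg : ∀ x, f x = y → (fderiv ℝ f x).det ≠ 0) : (f ⁻¹' {y}).Finite := by
  have hproper := isProperMap_iff_tendsto_cocompact.2 ⟨hf.continuous, hp⟩
  have hcomp : IsCompact (f ⁻¹' {y}) := hproper.isCompact_preimage isCompact_singleton
  choose! U hUo hxU hinj _ using fun x (hx : f x = y) => (exists_injOn_sign_const hf (hreg x hx)).1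
  obtain ⟨t, hts, ht⟩ := hcomp.elim_nhds_subcover U fun x hx => (hUo x hx).mem_nhds (hxU x hx)
  refine t.finite_toSet.subset fun x hx => ?_
  obtain ⟨z, hz, hxz⟩ := Set.mem_iUnion₂.1 (ht hx)
  have hzy : f z = y := hts z hz
  have hxy : f x = y := hx
  have := hinj z hzy hxz (hxU z hzy) (hxy.trans hzy.symm)
  exact this ▸ hz

lemma exists_radius_integral_eq {f : (ι → ℝ) → (ι → ℝ)} (hf : ContDiff ℝ ∞ f)
    (hp : Tendsto f (cocompact _) (cocompact _)) (y : ι → ℝ)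
    (hreg : ∀ x, f x = y → (fderiv ℝ f x).det ≠ 0) :
    ∃ r > 0, ∀ φ : (ι → ℝ) → ℝ, Continuous φ → (∀ z, r ≤ ‖z‖ → φ z = 0) →
      ∫ x, φ (f x - y) * (fderiv ℝ f x).det =
        (∑ᶠ x ∈ f ⁻¹' {y}, ((SignType.sign (fderiv ℝ f x).det : SignType) : ℝ)) * ∫ z, φ z := by
  have hproper := isProperMap_iff_tendsto_cocompact.2 ⟨hf.continuous, hp⟩
  have hfin := finite_preimage_of_regular hf hp y hreg
  choose! U hUo hxU hinj hsgn using
    fun x (hx : f x = y) => (exists_injOn_sign_const hf (hreg x hx)).1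
  obtain ⟨U', hU', hdisj⟩ := hfin.t2_separation
  set V : (ι → ℝ) → Set (ι → ℝ) := fun x => U x ∩ U' x with hV
  set S := hfin.toFinset with hS
  have hSmem : ∀ x, x ∈ S ↔ f x = y := fun x => by simp [hS]
  have hVo : ∀ x ∈ S, IsOpen (V x) := fun x hx => (hUo x ((hSmem x).1 hx)).inter (hU' x).2
  have hW : IsOpen (f '' (⋃ x ∈ S, V x)ᶜ)ᶜ :=
    (hproper.isClosedMap _ (isOpen_biUnion hVo).isClosed_compl).isOpen_compl
  have hyW : y ∈ (f '' (⋃ x ∈ S, V x)ᶜ)ᶜ := by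
    rintro ⟨x, hx, hxy⟩
    exact hx (Set.mem_biUnion ((hSmem x).2 hxy) ⟨hxU x hxy, (hU' x).1⟩)
  have hN : (f '' (⋃ x ∈ S, V x)ᶜ)ᶜ ∩ ⋂ x ∈ S, f '' V x ∈ 𝓝 y := by
    refine inter_mem (hW.mem_nhds hyW) ((biInter_finset_mem S).2 fun x hx => ?_)
    have hxy := (hSmem x).1 hx
    have := (exists_injOn_sign_const hf (hreg x hxy)).2
    rw [hxy] at this
    rw [← this]
    exact image_mem_map ((hVo x hx).mem_nhds ⟨hxU x hxy, (hU' x).1⟩)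
  obtain ⟨r, hr, hball⟩ := Metric.mem_nhds_iff.1 hN
  refine ⟨r, hr, fun φ hφ hφ0 => ?_⟩
  have hdet : Continuous fun x => (fderiv ℝ f x).det :=
    ContinuousLinearMap.continuous_det.comp (hf.continuous_fderiv (by simp))
  set g : (ι → ℝ) → ℝ := fun x => φ (f x - y) * (fderiv ℝ f x).det with hg
  have hgc : Continuous g := (hφ.comp (hf.continuous.sub continuous_const)).mul hdet
  have hg0 : ∀ x, f x ∉ Metric.ball y r → g x = 0 := fun x hx => by
    rw [Metric.mem_ball, dist_eq_norm, not_lt] at hx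
    simp [hg, hφ0 _ hx]
  have hgint : Integrable g := by
    refine hgc.integrable_of_hasCompactSupport (HasCompactSupport.intro
      (hproper.isCompact_preimage (isCompact_closedBall y r)) fun x hx => hg0 x fun h => ?_)
    exact hx (Metric.ball_subset_closedBall h)
  set B : (ι → ℝ) → Set (ι → ℝ) := fun x => V x ∩ f ⁻¹' Metric.ball y r with hB
  have hBo : ∀ x ∈ S, IsOpen (B x) := fun x hx =>
    (hVo x hx).inter (Metric.isOpen_ball.preimage hf.continuous)
  have h1 : ∫ x, g x = ∫ x in ⋃ x ∈ S, B x, g x := by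
    refine (setIntegral_eq_integral_of_forall_compl_eq_zero fun x hx => hg0 x fun h => hx ?_).symm
    have h2 := (hball h).1
    rw [Set.mem_compl_iff, Set.mem_image, not_exists] at h2
    have h3 : x ∈ ⋃ x ∈ S, V x := by
      by_contra h4; exact h2 x ⟨h4, rfl⟩
    obtain ⟨z, hz, hxz⟩ := Set.mem_iUnion₂.1 h3
    exact Set.mem_biUnion hz ⟨hxz, h⟩
  rw [h1, integral_biUnion_finset S (fun x hx => (hBo x hx).measurableSet) ?_
    fun x _ => hgint.integrableOn]
  swap
  · intro a ha b hb hab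
    have := hdisj (by simpa [hS] using ha) (by simpa [hS] using hb) hab
    exact this.mono (fun z hz => hz.1.2) (fun z hz => hz.1.2)
  rw [finsum_mem_eq_finite_toFinset_sum _ hfin, Finset.sum_mul]
  refine Finset.sum_congr rfl fun x hx => ?_
  have hxy := (hSmem x).1 hx
  have himg : f '' B x = Metric.ball y r := by
    apply Set.Subset.antisymm
    · rintro _ ⟨z, hz, rfl⟩; exact hz.2
    · intro z hz
      obtain ⟨u, hu, rfl⟩ := Set.mem_iInter₂.1 (hball hz).2 x hx
      exact ⟨u, ⟨hu, hz⟩, rfl⟩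
  have hcv := integral_image_eq_integral_abs_det_fderiv_smul volume (hBo x hx).measurableSet
    (fun z _ => (hf.differentiable (by simp) z).hasFDerivAt.hasFDerivWithinAt)
    ((hinj x hxy).mono fun z hz => hz.1.1) (fun z => φ (z - y))
  rw [himg, setIntegral_eq_integral_of_forall_compl_eq_zero,
    integral_sub_right_eq_self φ y] at hcv
  · rw [hcv, ← integral_const_mul]
    refine setIntegral_congr_fun (hBo x hx).measurableSet fun z hz => ?_
    simp only [hg, smul_eq_mul]
    rw [← hsgn x hxy z hz.1.1, ← mul_assoc, sign_mul_abs, mul_comm]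
  · intro z hz
    rw [Metric.mem_ball, dist_eq_norm, not_lt] at hz
    exact hφ0 _ hz

/-- The signed count of preimages of regular values of a proper smooth map is constant. -/
theorem finsum_sign_det_eq {f : (ι → ℝ) → (ι → ℝ)} (hf : ContDiff ℝ ∞ f)
    (hp : Tendsto f (cocompact _) (cocompact _)) (y₀ y₁ : ι → ℝ)
    (h₀ : ∀ x, f x = y₀ → (fderiv ℝ f x).det ≠ 0) (h₁ : ∀ x, f x = y₁ → (fderiv ℝ f x).det ≠ 0) :
    ∑ᶠ x ∈ f ⁻¹' {y₀}, ((SignType.sign (fderiv ℝ f x).det : SignType) : ℝ) =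
      ∑ᶠ x ∈ f ⁻¹' {y₁}, ((SignType.sign (fderiv ℝ f x).det : SignType) : ℝ) := by
  obtain ⟨r₀, hr₀, H₀⟩ := exists_radius_integral_eq hf hp y₀ h₀
  obtain ⟨r₁, hr₁, H₁⟩ := exists_radius_integral_eq hf hp y₁ h₁
  have hr : 0 < min r₀ r₁ := lt_min hr₀ hr₁
  let φ : ContDiffBump (0 : ι → ℝ) := ⟨min r₀ r₁ / 2, min r₀ r₁, by positivity, by linarith⟩
  have hz : ∀ z : ι → ℝ, min r₀ r₁ ≤ ‖z‖ → φ z = 0 := fun z hz =>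
    φ.zero_of_le_dist (by rw [dist_zero_right]; exact hz)
  have e₀ := H₀ φ φ.continuous fun z h => hz z ((min_le_left _ _).trans h)
  have e₁ := H₁ φ φ.continuous fun z h => hz z ((min_le_right _ _).trans h)
  have e := integral_comp_mul_det_eq hf hp (φ := φ) φ.contDiff φ.hasCompactSupport y₀ y₁
  rw [e₀, e₁] at e
  exact mul_right_cancel₀ (φ.integral_pos (μ := volume)).ne' e

end LocalDegree

section QuasiHomogeneous

open Filter Topology

variable {ι : Type*} [Fintype ι]

/-- A continuous quasi-homogeneous map with positive weights and trivial zero set is proper. -/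
theorem tendsto_cocompact_of_quasiHomogeneous {f : (ι → ℝ) → (ι → ℝ)} (hf : Continuous f)
    (a b : ι → ℕ) (ha : ∀ i, 1 ≤ a i) (hb : ∀ i, 1 ≤ b i)
    (hq : ∀ (t : ℝ) x j, t ≠ 0 → f (fun i => t ^ a i * x i) j = t ^ b j * f x j)
    (h0 : ∀ x, f x = 0 → x = 0) : Tendsto f (cocompact _) (cocompact _) := by
  obtain ⟨δ, hδ, hmin⟩ : ∃ δ > 0, ∀ z : ι → ℝ, ‖z‖ = 1 → δ ≤ ‖f z‖ := by
    rcases (Metric.sphere (0 : ι → ℝ) 1).eq_empty_or_nonempty with he | hne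
    · refine ⟨1, one_pos, fun z hz => ?_⟩
      have : z ∈ Metric.sphere (0 : ι → ℝ) 1 := by simpa using hz
      rw [he] at this; exact this.elim
    · obtain ⟨z₀, hz₀, hm⟩ := (isCompact_sphere (0 : ι → ℝ) 1).exists_isMinOn hne
        hf.norm.continuousOn
      refine ⟨‖f z₀‖, norm_pos_iff.2 fun h => ?_, fun z hz => hm (by simpa using hz)⟩
      rw [h0 z₀ h] at hz₀
      simp at hz₀
  set W := ∑ i, a i with hW
  have key : ∀ x : ι → ℝ, 1 ≤ ‖x‖ → δ ^ W * ‖x‖ ≤ ‖f x‖ ^ W := by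
    intro x hx
    have hgc : Continuous fun t : ℝ => ‖(fun i => t ^ a i * x i : ι → ℝ)‖ := by fun_prop
    have hg0 : ‖(fun i => (0:ℝ) ^ a i * x i : ι → ℝ)‖ = 0 := by
      rw [norm_eq_zero]; ext i
      simp [(Nat.one_le_iff_ne_zero.1 (ha i))]
    obtain ⟨t, ⟨ht0, ht1⟩, ht⟩ := intermediate_value_Icc (zero_le_one' ℝ) hgc.continuousOn
      (show (1:ℝ) ∈ Set.Icc _ _ from ⟨by rw [hg0]; exact zero_le_one, by simpa using hx⟩)
    have ht : ‖(fun i => t ^ a i * x i : ι → ℝ)‖ = 1 := ht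
    have htne : t ≠ 0 := by
      rintro rfl
      rw [hg0] at ht
      exact zero_ne_one ht
    have h1 : t ^ W * ‖x‖ ≤ 1 := by
      have : ‖(t ^ W) • x‖ ≤ 1 := by
        rw [pi_norm_le_iff_of_nonneg zero_le_one]
        intro i
        have h2 := norm_le_pi_norm (fun i => t ^ a i * x i : ι → ℝ) i
        rw [ht] at h2
        refine le_trans ?_ h2
        simp only [Pi.smul_apply, smul_eq_mul, norm_mul, norm_pow, Real.norm_of_nonneg ht0]
        refine mul_le_mul_of_nonneg_right (pow_le_pow_of_le_one ht0 ht1 ?_) (norm_nonneg _)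
        exact Finset.single_le_sum (fun i _ => Nat.zero_le (a i)) (Finset.mem_univ i)
      rwa [norm_smul, norm_pow, Real.norm_of_nonneg ht0] at this
    have h2 : δ ≤ t * ‖f x‖ := by
      refine (hmin _ ht).trans ?_
      rw [pi_norm_le_iff_of_nonneg (by positivity)]
      intro j
      rw [hq _ _ _ htne, norm_mul, norm_pow, Real.norm_of_nonneg ht0]
      refine mul_le_mul ?_ (norm_le_pi_norm _ _) (norm_nonneg _) ht0
      simpa using pow_le_pow_of_le_one ht0 ht1 (hb j)
    calc δ ^ W * ‖x‖ ≤ (t * ‖f x‖) ^ W * ‖x‖ := by gcongr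
      _ = (t ^ W * ‖x‖) * ‖f x‖ ^ W := by ring
      _ ≤ 1 * ‖f x‖ ^ W := by gcongr
      _ = _ := one_mul _
  rw [← Metric.cobounded_eq_cocompact, ← comap_norm_atTop, tendsto_comap_iff, tendsto_atTop]
  intro R
  have hev : ∀ᶠ x : ι → ℝ in comap norm atTop, max 1 (|R| ^ W / δ ^ W + 1) ≤ ‖x‖ :=
    tendsto_comap.eventually (eventually_ge_atTop _)
  filter_upwards [hev] with x hx
  by_contra hlt
  have hlt : ‖f x‖ < R := not_le.1 hlt
  have h3 := key x ((le_max_left _ _).trans hx)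
  have h4 : ‖f x‖ ^ W ≤ |R| ^ W := by
    gcongr; exact hlt.le.trans (le_abs_self R)
  have h5 := (le_max_right _ _).trans hx
  have h6 : ‖x‖ ≤ |R| ^ W / δ ^ W := by
    rw [le_div_iff₀ (by positivity)]
    linarith
  linarith

end QuasiHomogeneous

section FactorFamilies

variable {R : Type*} [CommRing R] {n : ℕ}

/-- `∏ Q_m ^ (m + 1)`. -/
noncomputable def fullProd (Q : Fin n → R[X]) : R[X] := ∏ m, Q m ^ ((m : ℕ) + 1)

/-- `∏ Q_m ^ m`, the common factor of `fullProd Q` and its derivative. -/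
noncomputable def critProd (Q : Fin n → R[X]) : R[X] := ∏ m, Q m ^ (m : ℕ)

/-- `∑ (m + 1) q_m ∏_{m' ≠ m} Q_m'`: the variation of `fullProd` divided by `critProd`. -/
noncomputable def tangentPoly (Q q : Fin n → R[X]) : R[X] :=
  ∑ m : Fin n, (((m : ℕ) + 1 : ℕ) : R[X]) * (q m * ∏ m' ∈ Finset.univ.erase m, Q m')

lemma fullProd_eq (Q : Fin n → R[X]) : fullProd Q = critProd Q * ∏ m, Q m := by
  simp [fullProd, critProd, pow_succ, Finset.prod_mul_distrib]

lemma sum_pow_variation (Q q : Fin n → R[X]) :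
    ∑ m : Fin n, (∏ m' ∈ Finset.univ.erase m, Q m' ^ ((m' : ℕ) + 1)) *
      ((((m : ℕ) + 1 : ℕ) : R[X]) * Q m ^ (m : ℕ) * q m) = critProd Q * tangentPoly Q q := by
  rw [tangentPoly, Finset.mul_sum]
  refine Finset.sum_congr rfl fun m _ => ?_
  rw [critProd, ← Finset.mul_prod_erase Finset.univ (fun m => Q m ^ (m : ℕ)) (Finset.mem_univ m)]
  simp only [pow_succ, Finset.prod_mul_distrib]
  ring

lemma derivative_fullProd (Q : Fin n → R[X]) :
    derivative (fullProd Q) = critProd Q * tangentPoly Q fun m => derivative (Q m) := by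
  rw [← sum_pow_variation, fullProd, derivative_prod_finset]
  refine Finset.sum_congr rfl fun m _ => ?_
  rw [derivative_pow]
  simp

lemma fullProd_monic {Q : Fin n → R[X]} (h : ∀ m, (Q m).Monic) : (fullProd Q).Monic :=
  monic_prod_of_monic _ _ fun m _ => (h m).pow _

lemma critProd_monic {Q : Fin n → R[X]} (h : ∀ m, (Q m).Monic) : (critProd Q).Monic :=
  monic_prod_of_monic _ _ fun m _ => (h m).pow _

lemma critProd_dvd_fullProd (Q : Fin n → R[X]) : critProd Q ∣ fullProd Q :=
  ⟨_, fullProd_eq Q⟩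

lemma natDegree_fullProd {Q : Fin n → R[X]} (h : ∀ m, (Q m).Monic) :
    (fullProd Q).natDegree = ∑ m : Fin n, ((m : ℕ) + 1) * (Q m).natDegree := by
  rw [fullProd, natDegree_prod_of_monic _ _ fun m _ => (h m).pow _]
  exact Finset.sum_congr rfl fun m _ => (h m).natDegree_pow _

lemma natDegree_critProd {Q : Fin n → R[X]} (h : ∀ m, (Q m).Monic) :
    (critProd Q).natDegree = ∑ m : Fin n, (m : ℕ) * (Q m).natDegree := by
  rw [critProd, natDegree_prod_of_monic _ _ fun m _ => (h m).pow _]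
  exact Finset.sum_congr rfl fun m _ => (h m).natDegree_pow _

/-- The variation of a family of monic polynomials has degree less than that of the product. -/
lemma degree_tangentPoly_lt [Nontrivial R] {Q q : Fin n → R[X]} (h : ∀ m, (Q m).Monic)
    (hq : ∀ m, (q m).degree < (Q m).degree) :
    (tangentPoly Q q).degree < ((∑ m, (Q m).natDegree : ℕ) : WithBot ℕ) := by
  refine (degree_sum_le _ _).trans_lt ((Finset.sup_lt_iff (WithBot.bot_lt_coe _)).2 fun m _ => ?_)
  have e1 : (((m : ℕ) + 1 : ℕ) : R[X]) = C (((m : ℕ) + 1 : ℕ) : R) := (map_natCast C _).symm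
  have hm : (∏ m' ∈ Finset.univ.erase m, Q m').Monic := monic_prod_of_monic _ _ fun m _ => h m
  rw [e1, ← smul_eq_C_mul]
  refine (degree_smul_le _ _).trans_lt ?_
  rw [hm.degree_mul]
  have e2 : ((∑ m, (Q m).natDegree : ℕ) : WithBot ℕ) =
      (Q m).degree + (∏ m' ∈ Finset.univ.erase m, Q m').degree := by
    rw [degree_eq_natDegree hm.ne_zero, degree_eq_natDegree (h m).ne_zero,
      natDegree_prod_of_monic _ _ fun m _ => h m, ← Nat.cast_add,
      Finset.add_sum_erase Finset.univ (fun m => (Q m).natDegree) (Finset.mem_univ m)]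
  rw [e2]
  by_cases hq0 : q m = 0
  · rw [hq0, degree_zero, WithBot.bot_add, degree_eq_natDegree hm.ne_zero,
      degree_eq_natDegree (h m).ne_zero, ← Nat.cast_add]
    exact WithBot.bot_lt_coe _
  · have := hq m
    rw [degree_eq_natDegree hq0, degree_eq_natDegree (h m).ne_zero] at this
    rw [degree_eq_natDegree hm.ne_zero, degree_eq_natDegree (h m).ne_zero,
      degree_eq_natDegree hq0]
    norm_cast at this ⊢
    omega

end FactorFamilies

section SeparableFamilies

variable {K : Type*} [Field K] {n : ℕ}

lemma exists_weighted_sum_eq (Q q : Fin n → K[X]) (c : Fin n → K[X]) (m : Fin n) :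
    ∃ S, ∑ m, c m * (q m * ∏ m' ∈ Finset.univ.erase m, Q m') =
      c m * (q m * ∏ m' ∈ Finset.univ.erase m, Q m') + Q m * S := by
  rw [← Finset.add_sum_erase _ _ (Finset.mem_univ m)]
  have : Q m ∣ ∑ m' ∈ Finset.univ.erase m, c m' * (q m' * ∏ m'' ∈ Finset.univ.erase m', Q m'') := by
    refine Finset.dvd_sum fun m' hm' => Dvd.dvd.mul_left (Dvd.dvd.mul_left ?_ _) _
    exact Finset.dvd_prod_of_mem _
      (Finset.mem_erase.2 ⟨(Finset.ne_of_mem_erase hm').symm, Finset.mem_univ _⟩)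
  obtain ⟨S, hS⟩ := this
  exact ⟨S, by rw [hS]⟩

lemma separable_of_isCoprime_tangentPoly {Q : Fin n → K[X]}
    (h : IsCoprime (tangentPoly Q fun m => derivative (Q m)) (∏ m, Q m)) :
    (∏ m, Q m).Separable := by
  rw [Polynomial.separable_def]
  refine IsCoprime.prod_left fun m _ => ?_
  have h1 : IsCoprime (tangentPoly Q fun m => derivative (Q m)) (Q m) :=
    IsCoprime.of_isCoprime_of_dvd_right h (Finset.dvd_prod_of_mem _ (Finset.mem_univ m))
  obtain ⟨S, hS⟩ := exists_weighted_sum_eq Q (fun m => derivative (Q m))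
    (fun m => (((m : ℕ) + 1 : ℕ) : K[X])) m
  obtain ⟨S', hS'⟩ := exists_weighted_sum_eq Q (fun m => derivative (Q m)) (fun _ => 1) m
  have h2 : derivative (∏ m, Q m) = ∑ m, 1 * (derivative (Q m) *
      ∏ m' ∈ Finset.univ.erase m, Q m') := by
    rw [derivative_prod_finset]
    exact Finset.sum_congr rfl fun m _ => by ring
  rw [tangentPoly, hS, IsCoprime.add_mul_left_left_iff] at h1
  rw [h2, hS', IsCoprime.add_mul_left_right_iff, one_mul]
  exact h1.of_mul_left_right.symm

lemma count_roots_fullProd {Q : Fin n → K[X]} (h : ∀ m, (Q m).Monic) (z : K) :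
    (fullProd Q).rootMultiplicity z = ∑ m : Fin n, ((m : ℕ) + 1) * (Q m).rootMultiplicity z := by
  rw [← count_roots, fullProd, roots_prod _ _ (fullProd_monic h).ne_zero]
  simp only [Multiset.count_bind, roots_pow, Multiset.count_nsmul, count_roots]
  rfl

lemma sum_rootMultiplicity_le {Q : Fin n → K[X]} (h : ∀ m, (Q m).Monic)
    (hs : (∏ m, Q m).Separable) (z : K) : ∑ m, (Q m).rootMultiplicity z ≤ 1 := by
  have h1 := Multiset.nodup_iff_count_le_one.1 (nodup_roots hs) z
  rw [roots_prod _ _ (monic_prod_of_monic _ _ fun m _ => h m).ne_zero] at h1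
  simp only [Multiset.count_bind, count_roots] at h1
  exact h1

lemma eval_eq_zero_iff_rootMultiplicity {Q : Fin n → K[X]} (h : ∀ m, (Q m).Monic)
    (hs : (∏ m, Q m).Separable) (z : K) (m : Fin n) :
    (Q m).eval z = 0 ↔ (fullProd Q).rootMultiplicity z = m + 1 := by
  have key : ∀ m, (Q m).eval z = 0 → (fullProd Q).rootMultiplicity z = m + 1 := by
    intro m hm
    have h1 : 0 < (Q m).rootMultiplicity z := (rootMultiplicity_pos (h m).ne_zero).2 hm
    have h2 := sum_rootMultiplicity_le h hs z
    rw [← Finset.add_sum_erase _ _ (Finset.mem_univ m)] at h2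
    have h3 : ∑ m' ∈ Finset.univ.erase m, (Q m').rootMultiplicity z = 0 := by omega
    have h4 : (Q m).rootMultiplicity z = 1 := by omega
    rw [count_roots_fullProd h, ← Finset.add_sum_erase _ _ (Finset.mem_univ m), h4,
      Finset.sum_eq_zero, mul_one, add_zero]
    intro m' hm'
    rw [Finset.sum_eq_zero_iff.1 h3 m' hm', mul_zero]
  refine ⟨key m, fun hm => ?_⟩
  have h5 : (fullProd Q).eval z = 0 := by
    have : 0 < (fullProd Q).rootMultiplicity z := by omega
    exact (rootMultiplicity_pos (fullProd_monic h).ne_zero).1 this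
  rw [fullProd, eval_prod, Finset.prod_eq_zero_iff] at h5
  obtain ⟨m', _, hm'⟩ := h5
  rw [eval_pow] at hm'
  have hm' := pow_eq_zero_iff (Nat.succ_ne_zero _) |>.1 hm'
  have h6 := key m' hm'
  have : m' = m := Fin.ext (by omega)
  rwa [this] at hm'

end SeparableFamilies

section RamificationFactors

variable {n : ℕ}

lemma map_fullProd {R S : Type*} [CommRing R] [CommRing S] (f : R →+* S) (Q : Fin n → R[X]) :
    (fullProd Q).map f = fullProd fun m => (Q m).map f := by
  simp [fullProd, Polynomial.map_prod]

/-- `Q` groups the roots of `P - w` by multiplicity: `Q m` has as its roots, all simple, the roots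
of `P - w` of multiplicity `m + 1`. -/
structure IsRamFactor (P : ℝ[X]) (w : ℝ) (Q : Fin n → ℝ[X]) : Prop where
  monic : ∀ m, (Q m).Monic
  eq : P - C w = fullProd Q
  sep : (∏ m, Q m).Separable

namespace IsRamFactor

variable {P : ℝ[X]} {w : ℝ} {Q : Fin n → ℝ[X]}

lemma map_monic (h : IsRamFactor P w Q) (m : Fin n) :
    ((Q m).map (algebraMap ℝ ℂ)).Monic := (h.monic m).map _

lemma map_sep (h : IsRamFactor P w Q) :
    (∏ m, (Q m).map (algebraMap ℝ ℂ)).Separable := by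
  rw [← Polynomial.map_prod]
  exact h.sep.map

lemma map_eq (h : IsRamFactor P w Q) :
    P.map (algebraMap ℝ ℂ) - C (w : ℂ) = fullProd fun m => (Q m).map (algebraMap ℝ ℂ) := by
  rw [← map_fullProd, ← h.eq, Polynomial.map_sub, map_C]
  rfl

lemma map_eval_eq_zero_iff (h : IsRamFactor P w Q) (z : ℂ) (m : Fin n) :
    ((Q m).map (algebraMap ℝ ℂ)).eval z = 0 ↔
      (P.map (algebraMap ℝ ℂ) - C (w : ℂ)).rootMultiplicity z = m + 1 := by
  rw [h.map_eq]
  exact eval_eq_zero_iff_rootMultiplicity h.map_monic h.map_sep z m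

lemma eval_eq_zero_iff (h : IsRamFactor P w Q) (z : ℝ) (m : Fin n) :
    (Q m).eval z = 0 ↔ (P - C w).rootMultiplicity z = m + 1 := by
  rw [h.eq]
  exact eval_eq_zero_iff_rootMultiplicity h.monic h.sep z m

lemma separable (h : IsRamFactor P w Q) (m : Fin n) : (Q m).Separable :=
  h.sep.of_dvd (Finset.dvd_prod_of_mem _ (Finset.mem_univ m))

lemma roots_map (h : IsRamFactor P w Q) (m : Fin n) :
    ((Q m).map (algebraMap ℝ ℂ)).roots =
      ((P.map (algebraMap ℝ ℂ) - C (w : ℂ)).roots.toFinset.filter fun z =>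
        (P.map (algebraMap ℝ ℂ) - C (w : ℂ)).rootMultiplicity z = m + 1).val := by
  refine Multiset.Nodup.ext (nodup_roots (h.separable m).map) (Finset.nodup _) |>.2 fun z => ?_
  have hne : P.map (algebraMap ℝ ℂ) - C (w : ℂ) ≠ 0 := by
    rw [h.map_eq]; exact (fullProd_monic h.map_monic).ne_zero
  rw [mem_roots (h.map_monic m).ne_zero, IsRoot.def, h.map_eval_eq_zero_iff, Finset.mem_val,
    Finset.mem_filter, Multiset.mem_toFinset, mem_roots hne]
  refine ⟨fun h1 => ⟨(rootMultiplicity_pos hne).1 (by omega), h1⟩, fun h1 => h1.2⟩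

lemma count_ramType (h : IsRamFactor P w Q) (m : Fin n) :
    (ramType P w).count ((m : ℕ) + 1) = (Q m).natDegree := by
  have h1 : (Q m).natDegree = ((Q m).map (algebraMap ℝ ℂ)).roots.card := by
    rw [← (IsAlgClosed.splits ((Q m).map (algebraMap ℝ ℂ))).natDegree_eq_card_roots,
      natDegree_map]
  rw [h1, h.roots_map, ramType, Multiset.count_map]
  simp only [Finset.filter_val, eq_comm]

lemma ext {Q' : Fin n → ℝ[X]} (h : IsRamFactor P w Q) (h' : IsRamFactor P w Q') : Q = Q' := by
  funext m
  apply Polynomial.map_injective _ (algebraMap ℝ ℂ).injective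
  have e : ∀ {Q : Fin n → ℝ[X]}, IsRamFactor P w Q → (Q m).map (algebraMap ℝ ℂ) =
      (((Q m).map (algebraMap ℝ ℂ)).roots.map fun a => X - C a).prod := fun h =>
    (IsAlgClosed.splits _).eq_prod_roots_of_monic (h.map_monic m)
  rw [e h, e h', h.roots_map, h'.roots_map]

end IsRamFactor

end RamificationFactors

section Existence

lemma exists_monic_fullProd_eq {K : Type*} [Field K] [CharZero K] {R : K[X]} (hR : R.Monic) :
    ∃ Q : Fin R.natDegree → K[X],
      (∀ m, (Q m).Monic) ∧ R = fullProd Q ∧ (∏ m, Q m).Separable := by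
  set s := UniqueFactorizationMonoid.normalizedFactors R with hs
  have hmem : ∀ p ∈ s, Irreducible p ∧ p.Monic ∧ p ∣ R := fun p hp =>
    (Polynomial.mem_normalizedFactors_iff hR.ne_zero).1 hp
  have hprod : s.prod = R := by
    have := leadingCoeff_mul_prod_normalizedFactors R
    rwa [hR.leadingCoeff, C_1, one_mul] at this
  have hcount : ∀ p ∈ s.toFinset, s.count p - 1 ∈ Finset.range R.natDegree := by
    intro p hp
    have hp := Multiset.mem_toFinset.1 hp
    have h1 : p ^ s.count p ∣ R := by
      refine Dvd.dvd.trans ?_ hprod.dvd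
      rw [← Multiset.prod_replicate]
      exact Multiset.prod_dvd_prod_of_le (Multiset.le_count_iff_replicate_le.1 le_rfl)
    have h2 := natDegree_le_of_dvd h1 hR.ne_zero
    have h3 : 0 < s.count p := Multiset.count_pos.2 hp
    have h4 : 0 < p.natDegree := (hmem p hp).1.natDegree_pos
    rw [natDegree_pow] at h2
    have := Nat.le_mul_of_pos_right (s.count p) h4
    rw [Finset.mem_range]
    omega
  have key : ∀ f : K[X] → K[X], ∏ m : Fin R.natDegree,
      ∏ p ∈ s.toFinset with s.count p - 1 = m, f p = ∏ p ∈ s.toFinset, f p := by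
    intro f
    rw [Fin.prod_univ_eq_prod_range (fun m => ∏ p ∈ s.toFinset with s.count p - 1 = m, f p)]
    exact Finset.prod_fiberwise_of_maps_to hcount f
  refine ⟨fun m => ∏ p ∈ s.toFinset with s.count p - 1 = m, p, fun m => ?_, ?_, ?_⟩
  · exact monic_prod_of_monic _ _ fun p hp =>
      (hmem p (Multiset.mem_toFinset.1 (Finset.mem_filter.1 hp).1)).2.1
  · rw [fullProd]
    simp only [← Finset.prod_pow]
    nth_rewrite 1 [← hprod]
    rw [Finset.prod_multiset_count, ← key]
    refine Finset.prod_congr rfl fun m _ => Finset.prod_congr rfl fun p hp => ?_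
    rw [Finset.mem_filter, Multiset.mem_toFinset] at hp
    have h3 : 0 < s.count p := Multiset.count_pos.2 hp.1
    rw [← hp.2, Nat.sub_add_cancel h3]
  · rw [key fun p => p]
    refine separable_prod' (fun p hp q hq hpq => ?_) fun p hp => ?_
    · have h1 := hmem p (Multiset.mem_toFinset.1 hp)
      have h2 := hmem q (Multiset.mem_toFinset.1 hq)
      refine (h1.1.isCoprime_or_dvd q).resolve_right fun h => hpq ?_
      exact eq_of_monic_of_associated h1.2.1 h2.2.1 (h1.1.associated_of_dvd h2.1 h)
    · exact (hmem p (Multiset.mem_toFinset.1 hp)).1.separable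

lemma exists_isRamFactor {n : ℕ} (hn : n ≠ 0) {P : ℝ[X]} (hP : P.Monic) (hd : P.natDegree = n)
    (w : ℝ) : ∃ Q : Fin n → ℝ[X], IsRamFactor P w Q := by
  have h1 : (P - C w).Monic := hP.sub_of_left (by
    rw [degree_eq_natDegree hP.ne_zero, hd]
    exact lt_of_le_of_lt degree_C_le (by exact_mod_cast Nat.pos_of_ne_zero hn))
  obtain rfl : (P - C w).natDegree = n := by rw [natDegree_sub_C, hd]
  obtain ⟨Q, h2, h3, h4⟩ := exists_monic_fullProd_eq h1
  exact ⟨Q, h2, h3, h4⟩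

end Existence

section Systems

variable {n : ℕ} {ι : Type*}

lemma isCoprime_sub_C {K : Type*} [Field K] (P : K[X]) {a b : K} (h : a ≠ b) :
    IsCoprime (P - C a) (P - C b) := by
  refine ⟨C (b - a)⁻¹, -C (b - a)⁻¹, ?_⟩
  have h1 : (b - a)⁻¹ * (b - a) = 1 := inv_mul_cancel₀ (sub_ne_zero.2 h.symm)
  calc C (b - a)⁻¹ * (P - C a) + -C (b - a)⁻¹ * (P - C b) = C ((b - a)⁻¹ * (b - a)) := by
        rw [C_mul, C_sub]; ring
    _ = 1 := by rw [h1, C_1]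

variable {P : ℝ[X]} {w : ι → ℝ} {Q : ι → Fin n → ℝ[X]}

lemma isCoprime_fullProd (hw : Function.Injective w) (heq : ∀ i, P - C (w i) = fullProd (Q i))
    {i j : ι} (hij : i ≠ j) : IsCoprime (fullProd (Q i)) (fullProd (Q j)) := by
  rw [← heq, ← heq]
  exact isCoprime_sub_C P (hw.ne hij)

lemma isCoprime_critProd (hw : Function.Injective w) (heq : ∀ i, P - C (w i) = fullProd (Q i))
    {i j : ι} (hij : i ≠ j) : IsCoprime (critProd (Q i)) (critProd (Q j)) :=
  ((isCoprime_fullProd hw heq hij).of_isCoprime_of_dvd_left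
    (critProd_dvd_fullProd _)).of_isCoprime_of_dvd_right (critProd_dvd_fullProd _)

lemma derivative_eq_of_sub_C {i : ι} (heq : P - C (w i) = fullProd (Q i)) :
    derivative P = critProd (Q i) * tangentPoly (Q i) fun m => derivative (Q i m) := by
  rw [← derivative_fullProd, ← heq, derivative_sub, derivative_C, sub_zero]

variable [Fintype ι]

lemma derivative_eq_prod_critProd (hw : Function.Injective w)
    (heq : ∀ i, P - C (w i) = fullProd (Q i)) (hmon : ∀ i m, (Q i m).Monic)
    (hP : P.Monic) (hdeg : P.natDegree = ∑ i, ∑ m : Fin n, (m : ℕ) * (Q i m).natDegree + 1) :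
    derivative P = C (P.natDegree : ℝ) * ∏ i, critProd (Q i) := by
  have h1 : (∏ i, critProd (Q i)).Monic :=
    monic_prod_of_monic _ _ fun i _ => critProd_monic (hmon i)
  have h2 : (∏ i, critProd (Q i)).natDegree + 1 = P.natDegree := by
    rw [natDegree_prod_of_monic _ _ fun i _ => critProd_monic (hmon i), hdeg]
    simp_rw [natDegree_critProd (hmon _)]
  have h3 : ∏ i, critProd (Q i) ∣ derivative P :=
    Finset.prod_dvd_of_coprime (fun i _ j _ hij => isCoprime_critProd hw heq hij)
      fun i _ => ⟨_, derivative_eq_of_sub_C (heq i)⟩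
  have h4 : (derivative P).natDegree = P.natDegree - 1 := natDegree_derivative P
  have h5 := eq_leadingCoeff_mul_of_monic_of_dvd_of_natDegree_le h1 h3 (by omega)
  rw [h5, leadingCoeff, h4, coeff_derivative, Nat.sub_add_cancel (by omega), hP.coeff_natDegree,
    one_mul, ← h2]
  simp

lemma tangentPoly_derivative_eq (heq : ∀ i, P - C (w i) = fullProd (Q i))
    (hmon : ∀ i m, (Q i m).Monic) {c : ℝ}
    (hder : derivative P = C c * ∏ i, critProd (Q i)) (i : ι) :
    tangentPoly (Q i) (fun m => derivative (Q i m)) =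
      C c * ∏ j ∈ Finset.univ.erase i, critProd (Q j) := by
  have h1 := derivative_eq_of_sub_C (heq i)
  rw [hder, ← Finset.mul_prod_erase _ _ (Finset.mem_univ i)] at h1
  refine mul_left_cancel₀ (critProd_monic (hmon i)).ne_zero (h1.symm.trans ?_)
  ring

lemma isRamFactor_of_tangentPoly_eq (hw : Function.Injective w)
    (heq : ∀ i, P - C (w i) = fullProd (Q i)) (hmon : ∀ i m, (Q i m).Monic) {c : ℝ} (hc : c ≠ 0)
    (htan : ∀ i, tangentPoly (Q i) (fun m => derivative (Q i m)) =
      C c * ∏ j ∈ Finset.univ.erase i, critProd (Q j)) (i : ι) :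
    IsRamFactor P (w i) (Q i) := by
  refine ⟨hmon i, heq i, separable_of_isCoprime_tangentPoly ?_⟩
  rw [htan]
  rw [isCoprime_mul_unit_left_left (isUnit_C.2 hc.isUnit)]
  refine IsCoprime.prod_left fun j hj => ?_
  refine ((isCoprime_fullProd hw heq (Finset.ne_of_mem_erase hj)).of_isCoprime_of_dvd_left
    (critProd_dvd_fullProd _)).of_isCoprime_of_dvd_right ?_
  rw [fullProd_eq]
  exact dvd_mul_left _ _

lemma IsRamFactor.ramType_eq {w : ℝ} {Q : Fin n → ℝ[X]} (h : IsRamFactor P w Q)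
    (hn : P.natDegree = n) {Λ : Multiset ℕ} (hΛ : IsPartitionOf n Λ)
    (hd : ∀ m : Fin n, (Q m).natDegree = Λ.count ((m : ℕ) + 1)) : ramType P w = Λ := by
  have hne : P.map (algebraMap ℝ ℂ) - C (w : ℂ) ≠ 0 := by
    rw [h.map_eq]; exact (fullProd_monic h.map_monic).ne_zero
  ext c
  rcases Nat.eq_zero_or_pos c with rfl | hc
  · rw [Multiset.count_eq_zero_of_notMem hΛ.2, Multiset.count_eq_zero_of_notMem]
    intro hmem
    obtain ⟨z, hz, hz'⟩ := Multiset.mem_map.1 hmem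
    rw [Finset.mem_val, Multiset.mem_toFinset, mem_roots hne] at hz
    exact absurd hz' ((rootMultiplicity_pos hne).2 hz).ne'
  · rcases le_or_gt c n with hcn | hcn
    · have := h.count_ramType ⟨c - 1, by omega⟩
      rw [hd] at this
      simpa only [Nat.sub_add_cancel hc] using this
    · rw [Multiset.count_eq_zero_of_notMem, Multiset.count_eq_zero_of_notMem]
      · intro hmem
        have := Multiset.le_sum_of_mem hmem
        rw [hΛ.1] at this
        omega
      · intro hmem
        obtain ⟨z, -, hz'⟩ := Multiset.mem_map.1 hmem
        have h1 : (P.map (algebraMap ℝ ℂ) - C (w : ℂ)).rootMultiplicity z ≤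
            (P.map (algebraMap ℝ ℂ) - C (w : ℂ)).natDegree := by
          rw [← count_roots]
          exact (Multiset.count_le_card _ _).trans (card_roots' _)
        rw [natDegree_sub_C, natDegree_map, hn] at h1
        omega

end Systems

section Coordinates

variable {n : ℕ} {ι : Type*}

/-- The coordinates: the non-leading coefficients of monic polynomials of degrees `d i m`. -/
abbrev RamIdx (d : ι → Fin n → ℕ) := Σ i, Σ m, Fin (d i m)

/-- The family of monic polynomials of degrees `d i m` with given coefficients. -/
noncomputable def polyFamily (d : ι → Fin n → ℕ) (x : RamIdx d → ℝ) (i : ι) (m : Fin n) : ℝ[X] :=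
  X ^ d i m + ∑ j : Fin (d i m), C (x ⟨i, m, j⟩) * X ^ (j : ℕ)

variable {d : ι → Fin n → ℕ}

lemma degree_sum_C_mul_X_pow_lt {e : ℕ} (c : Fin e → ℝ) :
    (∑ j : Fin e, C (c j) * X ^ (j : ℕ)).degree < (e : WithBot ℕ) := by
  refine (degree_sum_le _ _).trans_lt ((Finset.sup_lt_iff (WithBot.bot_lt_coe _)).2 fun j _ => ?_)
  exact (degree_C_mul_X_pow_le _ _).trans_lt (by exact_mod_cast j.2)

lemma coeff_sum_C_mul_X_pow {e : ℕ} (c : Fin e → ℝ) (j : Fin e) :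
    (∑ j : Fin e, C (c j) * X ^ (j : ℕ)).coeff j = c j := by
  simp only [finsetSum_coeff, coeff_C_mul, coeff_X_pow, Fin.val_inj, mul_ite, mul_one, mul_zero]
  simp

lemma polyFamily_monic (x : RamIdx d → ℝ) (i : ι) (m : Fin n) : (polyFamily d x i m).Monic :=
  monic_X_pow_add (degree_sum_C_mul_X_pow_lt _)

lemma natDegree_polyFamily (x : RamIdx d → ℝ) (i : ι) (m : Fin n) :
    (polyFamily d x i m).natDegree = d i m := by
  rw [polyFamily, natDegree_add_eq_left_of_degree_lt, natDegree_X_pow]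
  rw [degree_X_pow]
  exact degree_sum_C_mul_X_pow_lt _

lemma coeff_polyFamily (x : RamIdx d → ℝ) (i : ι) (m : Fin n) (j : Fin (d i m)) :
    (polyFamily d x i m).coeff j = x ⟨i, m, j⟩ := by
  rw [polyFamily, coeff_add, coeff_X_pow, if_neg j.2.ne, zero_add]
  exact coeff_sum_C_mul_X_pow (fun j => x ⟨i, m, j⟩) j

lemma polyFamily_injective : Function.Injective (polyFamily d) := by
  intro x y h
  funext ⟨i, m, j⟩
  rw [← coeff_polyFamily x, ← coeff_polyFamily y, h]

lemma exists_polyFamily_eq {Q : ι → Fin n → ℝ[X]} (hmon : ∀ i m, (Q i m).Monic)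
    (hdeg : ∀ i m, (Q i m).natDegree = d i m) : ∃ x, polyFamily d x = Q := by
  refine ⟨fun s => (Q s.1 s.2.1).coeff s.2.2, ?_⟩
  funext i m
  rw [polyFamily, (hmon i m).as_sum, hdeg i m,
    Finset.sum_range fun j => C ((Q i m).coeff j) * X ^ j]

lemma exists_finSigmaFinEquiv_eq {i : ι} {t : ℕ} (ht : t < ∑ m, d i m) :
    ∃ s : Σ m, Fin (d i m), (finSigmaFinEquiv s : ℕ) = t :=
  ⟨finSigmaFinEquiv.symm ⟨t, ht⟩, by rw [Equiv.apply_symm_apply]⟩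

variable [Fintype ι]

/-- The multiplicities `d i m` (number of roots of multiplicity `m + 1` over the `i`-th branch
point) have total degree `n` over each branch point and `n - 1` critical points overall. -/
structure IsRamData (d : ι → Fin n → ℕ) : Prop where
  sum_eq : ∀ i, ∑ m : Fin n, ((m : ℕ) + 1) * d i m = n
  crit : ∑ i, ∑ m : Fin n, (m : ℕ) * d i m + 1 = n

/-- The polynomial identity `P' = n ∏ critProd` divided by the `i`-th factor. -/
noncomputable def critDefect (d : ι → Fin n → ℕ) (x : RamIdx d → ℝ) (i : ι) : ℝ[X] :=
  tangentPoly (polyFamily d x i) (fun m => derivative (polyFamily d x i m)) -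
    C (n : ℝ) * ∏ j ∈ Finset.univ.erase i, critProd (polyFamily d x j)

/-- The map whose zeros (up to a translation of the target) are the normalized polynomials with
prescribed ramification. -/
noncomputable def ramMap (d : ι → Fin n → ℕ) (i₀ : ι) (x : RamIdx d → ℝ) : RamIdx d → ℝ :=
  fun s => if (finSigmaFinEquiv s.2 : ℕ) + 1 < ∑ m, d s.1 m then
      (critDefect d x s.1).coeff (finSigmaFinEquiv s.2)
    else if s.1 = i₀ then (fullProd (polyFamily d x i₀)).coeff (n - 1)
    else (fullProd (polyFamily d x s.1) - fullProd (polyFamily d x i₀)).coeff 0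

/-- The value of `ramMap` corresponding to the branch points `w`. -/
noncomputable def ramTarget (d : ι → Fin n → ℕ) (i₀ : ι) (w : ι → ℝ) : RamIdx d → ℝ :=
  fun s => if (finSigmaFinEquiv s.2 : ℕ) + 1 < ∑ m, d s.1 m then 0 else w i₀ - w s.1

lemma critProd_mul_critDefect (x : RamIdx d → ℝ) (i : ι) :
    critProd (polyFamily d x i) * critDefect d x i = derivative (fullProd (polyFamily d x i)) -
      C (n : ℝ) * ∏ j, critProd (polyFamily d x j) := by
  rw [critDefect, mul_sub, derivative_fullProd, ← Finset.mul_prod_erase _ _ (Finset.mem_univ i)]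
  ring

namespace IsRamData

variable (hd : IsRamData d)
include hd

lemma natDegree_fullProd (x : RamIdx d → ℝ) (i : ι) :
    (fullProd (polyFamily d x i)).natDegree = n := by
  rw [_root_.natDegree_fullProd (polyFamily_monic x i)]
  simp_rw [natDegree_polyFamily, hd.sum_eq]

lemma sum_add_sum_eq (i : ι) : ∑ m, d i m + ∑ m : Fin n, (m : ℕ) * d i m = n := by
  refine Eq.trans ?_ (hd.sum_eq i)
  rw [← Finset.sum_add_distrib]
  exact Finset.sum_congr rfl fun m _ => by ring

lemma sum_pos (i : ι) : 0 < ∑ m, d i m := by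
  have h1 := hd.crit
  have h2 := hd.sum_add_sum_eq i
  have h3 : ∑ m : Fin n, (m : ℕ) * d i m ≤ ∑ i, ∑ m : Fin n, (m : ℕ) * d i m :=
    Finset.single_le_sum (f := fun i => ∑ m : Fin n, (m : ℕ) * d i m) (fun _ _ => Nat.zero_le _)
      (Finset.mem_univ i)
  omega

lemma natDegree_prod_critProd (x : RamIdx d → ℝ) :
    (∏ i, critProd (polyFamily d x i)).natDegree = n - 1 := by
  rw [natDegree_prod_of_monic _ _ fun i _ => critProd_monic (polyFamily_monic x i)]
  simp_rw [natDegree_critProd (polyFamily_monic x _), natDegree_polyFamily]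
  have := hd.crit
  omega

lemma coeff_critDefect_eq_zero (x : RamIdx d → ℝ) (i : ι) {t : ℕ} (ht : ∑ m, d i m ≤ t + 1) :
    (critDefect d x i).coeff t = 0 := by
  have hn : 0 < n := by have := hd.crit; omega
  have h1 : (critProd (polyFamily d x i) * critDefect d x i).degree < ((n - 1 : ℕ) : WithBot ℕ) := by
    rw [critProd_mul_critDefect, degree_lt_iff_coeff_zero]
    intro m hm
    have e1 : (fullProd (polyFamily d x i)).Monic := fullProd_monic (polyFamily_monic x i)
    have e2 : (∏ j, critProd (polyFamily d x j)).Monic :=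
      monic_prod_of_monic _ _ fun i _ => critProd_monic (polyFamily_monic x i)
    have e3 := hd.natDegree_fullProd x i
    have e4 := hd.natDegree_prod_critProd x
    rw [coeff_sub, coeff_C_mul, coeff_derivative]
    rcases hm.eq_or_lt with rfl | hm
    · have e5 := e1.coeff_natDegree
      have e6 := e2.coeff_natDegree
      rw [e3] at e5
      rw [e4] at e6
      rw [Nat.sub_add_cancel hn, e5, e6, Nat.cast_sub hn]
      simp
    · rw [coeff_eq_zero_of_natDegree_lt (by omega), coeff_eq_zero_of_natDegree_lt (by omega)]
      simp
  have h2 := critProd_monic (polyFamily_monic x i)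
  rw [mul_comm, h2.degree_mul, degree_eq_natDegree h2.ne_zero,
    natDegree_critProd (polyFamily_monic x i)] at h1
  simp_rw [natDegree_polyFamily] at h1
  have h3 := hd.sum_add_sum_eq i
  by_contra hne
  have h4 := le_degree_of_ne_zero hne
  have h5 := (add_le_add_left h4 _).trans_lt h1
  have h6 : t + ∑ m : Fin n, (m : ℕ) * d i m < n - 1 := by exact_mod_cast h5
  omega

lemma critDefect_eq_zero_iff (x : RamIdx d → ℝ) (i : ι) :
    critDefect d x i = 0 ↔ ∀ s : Σ m, Fin (d i m), (finSigmaFinEquiv s : ℕ) + 1 < ∑ m, d i m →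
      (critDefect d x i).coeff (finSigmaFinEquiv s) = 0 := by
  refine ⟨fun h s _ => by rw [h, coeff_zero], fun h => ?_⟩
  ext t
  rw [coeff_zero]
  rcases lt_or_ge (t + 1) (∑ m, d i m) with ht | ht
  · obtain ⟨s, rfl⟩ := exists_finSigmaFinEquiv_eq (d := d) (i := i) (t := t) (by omega)
    exact h s ht
  · exact hd.coeff_critDefect_eq_zero x i ht

/-- Points over `ramTarget d i₀ w` are solutions of a system of polynomial identities. -/
lemma ramMap_eq_iff (i₀ : ι) (w : ι → ℝ) (x : RamIdx d → ℝ) :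
    ramMap d i₀ x = ramTarget d i₀ w ↔ (∀ i, critDefect d x i = 0) ∧
      (fullProd (polyFamily d x i₀)).coeff (n - 1) = 0 ∧
      ∀ i, fullProd (polyFamily d x i) + C (w i) = fullProd (polyFamily d x i₀) + C (w i₀) := by
  constructor
  · intro h
    have h0 : ∀ i, critDefect d x i = 0 := by
      intro i
      rw [hd.critDefect_eq_zero_iff]
      intro s hs
      have := congrFun h ⟨i, s⟩
      simpa only [ramMap, ramTarget, if_pos hs] using this
    have h1 : ∀ i, (if i = i₀ then (fullProd (polyFamily d x i₀)).coeff (n - 1)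
        else (fullProd (polyFamily d x i) - fullProd (polyFamily d x i₀)).coeff 0) =
        w i₀ - w i := by
      intro i
      have hpos := hd.sum_pos i
      obtain ⟨s, hs⟩ := exists_finSigmaFinEquiv_eq (d := d) (i := i)
        (t := ∑ m, d i m - 1) (by omega)
      have hs' : ¬ ((finSigmaFinEquiv s : ℕ) + 1 < ∑ m, d i m) := by omega
      have := congrFun h ⟨i, s⟩
      simpa only [ramMap, ramTarget, if_neg hs'] using this
    refine ⟨h0, by simpa using h1 i₀, fun i => ?_⟩
    by_cases hi : i = i₀
    · rw [hi]
    have h2 := h1 i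
    rw [if_neg hi] at h2
    have h3 : derivative (fullProd (polyFamily d x i) - fullProd (polyFamily d x i₀)) = 0 := by
      have e1 := critProd_mul_critDefect x i
      have e2 := critProd_mul_critDefect x i₀
      rw [h0, mul_zero] at e1 e2
      rw [derivative_sub, sub_eq_zero.1 e1.symm, sub_eq_zero.1 e2.symm, sub_self]
    have h4 := eq_C_of_natDegree_eq_zero (derivative_eq_zero.1 h3)
    rw [h2, C_sub] at h4
    linear_combination h4
  · rintro ⟨h0, h1, h2⟩
    funext ⟨i, s⟩
    simp only [ramMap, ramTarget]
    split_ifs with hs hi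
    · rw [h0, coeff_zero]
    · rw [h1, hi, sub_self]
    · have h3 : fullProd (polyFamily d x i) - fullProd (polyFamily d x i₀) =
          C (w i₀ - w i) := by
        rw [C_sub]
        linear_combination h2 i
      rw [h3, coeff_C_zero]

end IsRamData

end Coordinates

section Solutions

variable {n : ℕ} {ι : Type*} [Fintype ι] {d : ι → Fin n → ℕ}

/-- The polynomial with coordinates `x`. -/
noncomputable def ramPoly (d : ι → Fin n → ℕ) (i₀ : ι) (w : ι → ℝ) (x : RamIdx d → ℝ) : ℝ[X] :=
  fullProd (polyFamily d x i₀) + C (w i₀)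

namespace IsRamData

variable (hd : IsRamData d) {i₀ : ι} {w : ι → ℝ}
include hd

lemma ne_zero : n ≠ 0 := by
  have := hd.crit
  omega

lemma ramPoly_sub_C {x : RamIdx d → ℝ} (hx : ramMap d i₀ x = ramTarget d i₀ w) (i : ι) :
    ramPoly d i₀ w x - C (w i) = fullProd (polyFamily d x i) := by
  rw [ramPoly, ← ((hd.ramMap_eq_iff i₀ w x).1 hx).2.2 i, add_sub_cancel_right]

lemma isRamFactor (hw : Function.Injective w) {x : RamIdx d → ℝ}
    (hx : ramMap d i₀ x = ramTarget d i₀ w) (i : ι) :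
    IsRamFactor (ramPoly d i₀ w x) (w i) (polyFamily d x i) :=
  isRamFactor_of_tangentPoly_eq hw (hd.ramPoly_sub_C hx) (polyFamily_monic x)
    (Nat.cast_ne_zero.2 hd.ne_zero)
    (fun i => sub_eq_zero.1 (((hd.ramMap_eq_iff i₀ w x).1 hx).1 i)) i

lemma natDegree_ramPoly (x : RamIdx d → ℝ) : (ramPoly d i₀ w x).natDegree = n := by
  rw [ramPoly, natDegree_add_C, hd.natDegree_fullProd]

lemma isNormalized_ramPoly (hn : 1 < n) {x : RamIdx d → ℝ}
    (hx : ramMap d i₀ x = ramTarget d i₀ w) : IsNormalized n (ramPoly d i₀ w x) := by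
  refine ⟨hd.natDegree_ramPoly x, ?_, ?_⟩
  · have h := fullProd_monic (polyFamily_monic x i₀)
    refine h.add_of_left ?_
    rw [degree_eq_natDegree h.ne_zero, hd.natDegree_fullProd]
    exact degree_C_le.trans_lt (by exact_mod_cast Nat.pos_of_ne_zero hd.ne_zero)
  · rw [ramPoly, coeff_add, ((hd.ramMap_eq_iff i₀ w x).1 hx).2.1, coeff_C_of_ne_zero (by omega),
      add_zero]

lemma derivative_ramPoly {x : RamIdx d → ℝ} (hx : ramMap d i₀ x = ramTarget d i₀ w) :
    derivative (ramPoly d i₀ w x) = C (n : ℝ) * ∏ i, critProd (polyFamily d x i) := by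
  rw [derivative_eq_of_sub_C (hd.ramPoly_sub_C hx i₀),
    sub_eq_zero.1 (((hd.ramMap_eq_iff i₀ w x).1 hx).1 i₀),
    ← Finset.mul_prod_erase _ _ (Finset.mem_univ i₀)]
  ring

end IsRamData

lemma bijOn_ramPoly {k : ℕ} {Λ : Fin k → Multiset ℕ} (hΛ : ∀ i, IsPartitionOf n (Λ i))
    {d : Fin k → Fin n → ℕ} (hd : IsRamData d)
    (hΛd : ∀ i (m : Fin n), d i m = (Λ i).count ((m : ℕ) + 1)) (hn : 1 < n)
    {w : Fin k → ℝ} (hw : Function.Injective w) (i₀ : Fin k) :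
    Set.BijOn (ramPoly d i₀ w) (ramMap d i₀ ⁻¹' {ramTarget d i₀ w}) (sSet n Λ w) := by
  refine ⟨fun x hx => ⟨hd.isNormalized_ramPoly hn hx, fun i => ?_⟩, fun x hx y hy h => ?_, ?_⟩
  · refine (hd.isRamFactor hw hx i).ramType_eq (hd.natDegree_ramPoly x) (hΛ i) fun m => ?_
    rw [natDegree_polyFamily, hΛd]
  · refine polyFamily_injective (funext fun i => ?_)
    have h1 := hd.isRamFactor hw hx i
    rw [h] at h1
    exact h1.ext (hd.isRamFactor hw hy i)
  · rintro P ⟨⟨hdeg, hmon, hcoeff⟩, hram⟩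
    choose Q hQ using fun i => exists_isRamFactor hd.ne_zero hmon hdeg (w i)
    have hQd : ∀ i m, (Q i m).natDegree = d i m := fun i m => by
      rw [← (hQ i).count_ramType, hram, hΛd]
    obtain ⟨x, rfl⟩ := exists_polyFamily_eq (fun i => (hQ i).monic) hQd
    have hP : ramPoly d i₀ w x = P := by
      rw [ramPoly, ← (hQ i₀).eq, sub_add_cancel]
    refine ⟨x, ?_, hP⟩
    have hder := derivative_eq_prod_critProd hw (fun i => (hQ i).eq) (fun i => (hQ i).monic) hmon
      (by simp_rw [hdeg, natDegree_polyFamily, hd.crit])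
    rw [hdeg] at hder
    refine (hd.ramMap_eq_iff i₀ w x).2 ⟨fun i => ?_, ?_, fun i => ?_⟩
    · exact sub_eq_zero.2
        (tangentPoly_derivative_eq (fun i => (hQ i).eq) (fun i => (hQ i).monic) hder i)
    · rw [← (hQ i₀).eq, coeff_sub, hcoeff, coeff_C_of_ne_zero (by omega), sub_zero]
    · rw [← (hQ i).eq, ← (hQ i₀).eq]
      ring

end Solutions

section Properness

variable {n : ℕ} {ι : Type*} {d : ι → Fin n → ℕ}

lemma eq_X_pow_of_derivative_roots {P : ℂ[X]} (hP : P.Monic) (hdeg : P.natDegree ≠ 0)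
    (hroots : ∀ z, (derivative P).eval z = 0 → P.eval z = 0)
    (hcoeff : P.coeff (P.natDegree - 1) = 0) : P = X ^ P.natDegree := by
  have hder : derivative P ≠ 0 := fun h => hdeg (derivative_eq_zero.1 h)
  have h1 : ∑ z ∈ P.roots.toFinset, P.roots.count z = P.natDegree := by
    rw [Multiset.toFinset_sum_count_eq, (IsAlgClosed.splits P).natDegree_eq_card_roots]
  have h2 : ∑ z ∈ P.roots.toFinset, (derivative P).roots.count z = P.natDegree - 1 := by
    rw [← natDegree_derivative, (IsAlgClosed.splits (derivative P)).natDegree_eq_card_roots,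
      Multiset.sum_count_eq_card]
    intro z hz
    rw [mem_roots hder] at hz
    rw [Multiset.mem_toFinset, mem_roots hP.ne_zero]
    exact hroots z hz
  have h3 : ∀ z ∈ P.roots.toFinset, P.roots.count z = (derivative P).roots.count z + 1 := by
    intro z hz
    rw [Multiset.mem_toFinset, mem_roots hP.ne_zero] at hz
    have h4 := derivative_rootMultiplicity_of_root hz
    have h5 := (rootMultiplicity_pos hP.ne_zero).2 hz
    rw [count_roots, count_roots]
    omega
  rw [Finset.sum_congr rfl h3, Finset.sum_add_distrib, h2, Finset.sum_const, smul_eq_mul,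
    mul_one] at h1
  obtain ⟨a, ha⟩ := Finset.card_eq_one.1 (show P.roots.toFinset.card = 1 by omega)
  have h4 : P.roots = Multiset.replicate P.natDegree a := by
    refine Multiset.eq_replicate.2
      ⟨(IsAlgClosed.splits P).natDegree_eq_card_roots.symm, fun b hb => ?_⟩
    rw [← Multiset.mem_toFinset, ha] at hb
    exact Finset.mem_singleton.1 hb
  have h5 : P = (X - C a) ^ P.natDegree := by
    have := (IsAlgClosed.splits P).eq_prod_roots_of_monic hP
    rwa [h4, Multiset.map_replicate, Multiset.prod_replicate] at this
  have h6 : a = 0 := by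
    rw [h5, natDegree_pow, natDegree_X_sub_C, mul_one, sub_eq_add_neg X, ← C_neg, coeff_X_add_C_pow, Nat.sub_sub_self (by omega),
      pow_one] at hcoeff
    have h7 : P.natDegree.choose (P.natDegree - 1) ≠ 0 :=
      (Nat.choose_pos (Nat.sub_le _ _)).ne'
    simpa [h7] using hcoeff
  rwa [h6, C_0, sub_zero] at h5

/-- The scaling action on the coordinates. -/
def ramScale (d : ι → Fin n → ℕ) (t : ℝ) (x : RamIdx d → ℝ) : RamIdx d → ℝ :=
  fun s => t ^ (d s.1 s.2.1 - s.2.2) * x s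

lemma polyFamily_ramScale (t : ℝ) (x : RamIdx d → ℝ) (i : ι) (m : Fin n) :
    (polyFamily d (ramScale d t x) i m).comp (C t * X) = C t ^ d i m * polyFamily d x i m := by
  simp only [polyFamily, ramScale, add_comp, X_pow_comp, mul_add, mul_pow, Polynomial.sum_comp, mul_comp,
    C_comp, Finset.mul_sum]
  congr 1
  refine Finset.sum_congr rfl fun j _ => ?_
  have h : (C t : ℝ[X]) ^ d i m = C t ^ (d i m - (j : ℕ)) * C t ^ (j : ℕ) := by
    rw [← pow_add, Nat.sub_add_cancel j.2.le]
  rw [h, C_mul, C_pow]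
  ring

lemma fullProd_ramScale (t : ℝ) (x : RamIdx d → ℝ) (i : ι) :
    (fullProd (polyFamily d (ramScale d t x) i)).comp (C t * X) =
      C t ^ (∑ m : Fin n, ((m : ℕ) + 1) * d i m) * fullProd (polyFamily d x i) := by
  simp only [fullProd, Polynomial.prod_comp, pow_comp, polyFamily_ramScale, mul_pow,
    Finset.prod_mul_distrib, ← pow_mul, Finset.prod_pow_eq_pow_sum]
  simp only [mul_comm]

lemma critProd_ramScale (t : ℝ) (x : RamIdx d → ℝ) (i : ι) :
    (critProd (polyFamily d (ramScale d t x) i)).comp (C t * X) =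
      C t ^ (∑ m : Fin n, (m : ℕ) * d i m) * critProd (polyFamily d x i) := by
  simp only [critProd, Polynomial.prod_comp, pow_comp, polyFamily_ramScale, mul_pow,
    Finset.prod_mul_distrib, ← pow_mul, Finset.prod_pow_eq_pow_sum]
  simp only [mul_comm]

lemma tangentPoly_ramScale (t : ℝ) (x : RamIdx d → ℝ) (i : ι) :
    C t * (tangentPoly (polyFamily d (ramScale d t x) i)
        (fun m => derivative (polyFamily d (ramScale d t x) i m))).comp (C t * X) =
      C t ^ (∑ m, d i m) * tangentPoly (polyFamily d x i)
        (fun m => derivative (polyFamily d x i m)) := by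
  have h : ∀ m, C t * (derivative (polyFamily d (ramScale d t x) i m)).comp (C t * X) =
      C t ^ d i m * derivative (polyFamily d x i m) := by
    intro m
    have h1 := congrArg derivative (polyFamily_ramScale t x i m)
    rw [derivative_comp, derivative_C_mul, derivative_X, mul_one, ← C_pow, derivative_C_mul] at h1
    rw [h1, C_pow]
  simp only [tangentPoly, Polynomial.sum_comp, mul_comp, Polynomial.prod_comp, polyFamily_ramScale,
    Finset.mul_sum, natCast_comp, Finset.prod_mul_distrib, Finset.prod_pow_eq_pow_sum]
  refine Finset.sum_congr rfl fun m _ => ?_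
  rw [← Finset.add_sum_erase _ _ (Finset.mem_univ m), pow_add]
  linear_combination (((m : ℕ) + 1 : ℕ) : ℝ[X]) * (C t ^ (∑ m ∈ Finset.univ.erase m, d i m)) *
    (∏ m' ∈ Finset.univ.erase m, polyFamily d x i m') * h m

variable [Fintype ι]

namespace IsRamData

variable (hd : IsRamData d)
include hd

lemma critDefect_ramScale (t : ℝ) (x : RamIdx d → ℝ) (i : ι) :
    C t * (critDefect d (ramScale d t x) i).comp (C t * X) =
      C t ^ (∑ m, d i m) * critDefect d x i := by
  have h1 : ∑ j ∈ Finset.univ.erase i, ∑ m : Fin n, (m : ℕ) * d j m + 1 = ∑ m, d i m := by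
    have e1 := hd.crit
    have e2 := hd.sum_add_sum_eq i
    rw [← Finset.add_sum_erase _ _ (Finset.mem_univ i)] at e1
    omega
  rw [critDefect, critDefect, sub_comp, mul_sub, tangentPoly_ramScale, mul_sub, mul_comp, C_comp,
    Polynomial.prod_comp]
  simp only [critProd_ramScale, Finset.prod_mul_distrib, Finset.prod_pow_eq_pow_sum]
  rw [← h1, pow_succ]
  ring

/-- The weights of the coordinates of `ramMap`. -/
noncomputable def _root_.ramWeight (d : ι → Fin n → ℕ) (i₀ : ι) (s : RamIdx d) : ℕ :=
  if (finSigmaFinEquiv s.2 : ℕ) + 1 < ∑ m, d s.1 m then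
    ∑ m, d s.1 m - (finSigmaFinEquiv s.2 + 1) else if s.1 = i₀ then 1 else n

lemma ramMap_ramScale (i₀ : ι) {t : ℝ} (ht : t ≠ 0) (x : RamIdx d → ℝ) (s : RamIdx d) :
    ramMap d i₀ (ramScale d t x) s = t ^ ramWeight d i₀ s * ramMap d i₀ x s := by
  have key : ∀ i j, (fullProd (polyFamily d (ramScale d t x) i)).coeff j * t ^ j =
      t ^ n * (fullProd (polyFamily d x i)).coeff j := by
    intro i j
    have h1 := congrArg (fun p => p.coeff j) (fullProd_ramScale t x i)
    simp only [hd.sum_eq, comp_C_mul_X_coeff, ← C_pow, coeff_C_mul] at h1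
    exact h1
  have hn := hd.ne_zero
  simp only [ramMap, ramWeight]
  split_ifs with h1 h2
  · have h3 := congrArg (fun p => p.coeff (finSigmaFinEquiv s.2)) (hd.critDefect_ramScale t x s.1)
    simp only [comp_C_mul_X_coeff, ← C_pow, coeff_C_mul] at h3
    refine mul_right_cancel₀ (pow_ne_zero ((finSigmaFinEquiv s.2 : ℕ) + 1) ht) ?_
    rw [mul_right_comm, ← pow_add, Nat.sub_add_cancel h1.le, ← h3]
    ring
  · refine mul_right_cancel₀ (pow_ne_zero (n - 1) ht) ?_
    rw [key, mul_right_comm, ← pow_add, Nat.add_sub_cancel' (Nat.pos_of_ne_zero hn)]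
  · have h3 := key s.1 0
    have h4 := key i₀ 0
    rw [pow_zero, mul_one] at h3 h4
    rw [coeff_sub, coeff_sub, h3, h4]
    ring

lemma eq_zero_of_ramMap_eq_zero (i₀ : ι) {x : RamIdx d → ℝ} (hx : ramMap d i₀ x = 0) : x = 0 := by
  have h0 : ramMap d i₀ x = ramTarget d i₀ (fun _ => 0) := by
    rw [hx]
    funext s
    simp [ramTarget]
  have h1 := (hd.ramMap_eq_iff i₀ (fun _ => 0) x).1 h0
  have hder := hd.derivative_ramPoly h0
  have heq : ∀ i, fullProd (polyFamily d x i) = fullProd (polyFamily d x i₀) := fun i => by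
    simpa using h1.2.2 i
  have hP : ramPoly d i₀ (fun _ => 0) x = fullProd (polyFamily d x i₀) := by
    simp [ramPoly]
  rw [hP] at hder
  set P := fullProd (polyFamily d x i₀) with hPdef
  have hmon : P.Monic := fullProd_monic (polyFamily_monic x i₀)
  have hdeg : P.natDegree = n := hd.natDegree_fullProd x i₀
  have h2 : P.map (algebraMap ℝ ℂ) = X ^ (P.map (algebraMap ℝ ℂ)).natDegree := by
    refine eq_X_pow_of_derivative_roots (hmon.map _) ?_ (fun z hz => ?_) ?_
    · rw [natDegree_map, hdeg]
      exact hd.ne_zero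
    · rw [derivative_map, hder, Polynomial.map_mul, map_C, Polynomial.map_prod, eval_mul, eval_C,
        eval_prod] at hz
      rcases mul_eq_zero.1 hz with hz | hz
      · exact absurd hz (by simpa using hd.ne_zero)
      · obtain ⟨i, -, hi⟩ := Finset.prod_eq_zero_iff.1 hz
        rw [← heq i, fullProd_eq, Polynomial.map_mul, eval_mul, hi, zero_mul]
    · rw [natDegree_map, hdeg, coeff_map, h1.2.1, map_zero]
  rw [natDegree_map, hdeg] at h2
  have h3 : P = X ^ n := by
    apply Polynomial.map_injective _ (algebraMap ℝ ℂ).injective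
    rw [h2, Polynomial.map_pow, map_X]
  funext ⟨i, m, j⟩
  have h4 : polyFamily d x i m ∣ X ^ n := by
    rw [← h3, ← heq i, fullProd]
    exact (dvd_pow_self _ (Nat.succ_ne_zero _)).trans
      (Finset.dvd_prod_of_mem (fun m : Fin n => polyFamily d x i m ^ ((m : ℕ) + 1))
        (Finset.mem_univ m))
  obtain ⟨e, -, he⟩ := (dvd_prime_pow prime_X n).1 h4
  have h5 := eq_of_monic_of_associated (polyFamily_monic x i m) (monic_X_pow e) he
  have h6 := natDegree_polyFamily x i m
  rw [h5, natDegree_X_pow] at h6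
  rw [← coeff_polyFamily x, h5, coeff_X_pow, if_neg (by have := j.2; omega), Pi.zero_apply]

end IsRamData

end Properness

section CoefficientCalculus

open scoped ContDiff

variable {E : Type*} [NormedAddCommGroup E] [NormedSpace ℝ E]

/-- All coefficients of a family of polynomials are smooth functions of the parameter. -/
def CoeffSmooth (p : E → ℝ[X]) : Prop := ∀ j, ContDiff ℝ ∞ fun x => (p x).coeff j

namespace CoeffSmooth

variable {p q : E → ℝ[X]}

lemma const (p : ℝ[X]) : CoeffSmooth fun _ : E => p := fun _ => contDiff_const

lemma add (hp : CoeffSmooth p) (hq : CoeffSmooth q) : CoeffSmooth fun x => p x + q x := fun j => by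
  simp only [coeff_add]
  exact (hp j).add (hq j)

lemma sub (hp : CoeffSmooth p) (hq : CoeffSmooth q) : CoeffSmooth fun x => p x - q x := fun j => by
  simp only [coeff_sub]
  exact (hp j).sub (hq j)

lemma mul (hp : CoeffSmooth p) (hq : CoeffSmooth q) : CoeffSmooth fun x => p x * q x := fun j => by
  simp only [coeff_mul]
  exact ContDiff.sum fun a _ => (hp a.1).mul (hq a.2)

lemma sum {α : Type*} {s : Finset α} {p : α → E → ℝ[X]} (h : ∀ a ∈ s, CoeffSmooth (p a)) :
    CoeffSmooth fun x => ∑ a ∈ s, p a x := fun j => by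
  simp only [finsetSum_coeff]
  exact ContDiff.sum fun a ha => h a ha j

lemma prod {α : Type*} {s : Finset α} {p : α → E → ℝ[X]} (h : ∀ a ∈ s, CoeffSmooth (p a)) :
    CoeffSmooth fun x => ∏ a ∈ s, p a x := by
  induction s using Finset.induction_on with
  | empty => simpa using const 1
  | insert a s ha ih =>
    simp only [Finset.prod_insert ha]
    exact (h a (Finset.mem_insert_self _ _)).mul
      (ih fun b hb => h b (Finset.mem_insert_of_mem hb))

lemma pow (hp : CoeffSmooth p) (e : ℕ) : CoeffSmooth fun x => p x ^ e := by
  induction e with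
  | zero => simpa using const 1
  | succ e ih => simpa only [pow_succ] using ih.mul hp

lemma derivative (hp : CoeffSmooth p) : CoeffSmooth fun x => derivative (p x) := fun j => by
  simp only [coeff_derivative]
  exact (hp (j + 1)).mul contDiff_const

end CoeffSmooth

/-- The curve `p` of polynomials has derivative `p'` at `0`, coefficientwise. -/
def HasCoeffDeriv (p : ℝ → ℝ[X]) (p' : ℝ[X]) : Prop :=
  ∀ j, HasDerivAt (fun t => (p t).coeff j) (p'.coeff j) 0

namespace HasCoeffDeriv

variable {p q : ℝ → ℝ[X]} {p' q' : ℝ[X]}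

lemma unique (hp : HasCoeffDeriv p p') (hq : HasCoeffDeriv p q') : p' = q' := by
  ext j
  exact (hp j).unique (hq j)

lemma const (p : ℝ[X]) : HasCoeffDeriv (fun _ => p) 0 := fun j => by
  simpa using hasDerivAt_const (0 : ℝ) (p.coeff j)

lemma sub (hp : HasCoeffDeriv p p') (hq : HasCoeffDeriv q q') :
    HasCoeffDeriv (fun t => p t - q t) (p' - q') := fun j => by
  simp only [coeff_sub]
  exact (hp j).sub (hq j)

lemma mul (hp : HasCoeffDeriv p p') (hq : HasCoeffDeriv q q') :
    HasCoeffDeriv (fun t => p t * q t) (p' * q 0 + p 0 * q') := fun j => by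
  simp only [coeff_mul, coeff_add, ← Finset.sum_add_distrib]
  exact HasDerivAt.fun_sum fun a _ => (hp a.1).mul (hq a.2)

lemma sum {α : Type*} {s : Finset α} {p : α → ℝ → ℝ[X]} {p' : α → ℝ[X]}
    (h : ∀ a ∈ s, HasCoeffDeriv (p a) (p' a)) :
    HasCoeffDeriv (fun t => ∑ a ∈ s, p a t) (∑ a ∈ s, p' a) := fun j => by
  simp only [finsetSum_coeff]
  exact HasDerivAt.fun_sum fun a ha => h a ha j

lemma prod {α : Type*} {s : Finset α} {p : α → ℝ → ℝ[X]} {p' : α → ℝ[X]}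
    (h : ∀ a ∈ s, HasCoeffDeriv (p a) (p' a)) :
    HasCoeffDeriv (fun t => ∏ a ∈ s, p a t) (∑ a ∈ s, (∏ b ∈ s.erase a, p b 0) * p' a) := by
  induction s using Finset.induction_on with
  | empty => simpa using const 1
  | insert a s ha ih =>
    simp only [Finset.prod_insert ha]
    convert (h a (Finset.mem_insert_self _ _)).mul
      (ih fun b hb => h b (Finset.mem_insert_of_mem hb)) using 1
    rw [Finset.sum_insert ha, Finset.erase_insert ha, mul_comm, Finset.mul_sum]
    congr 1
    refine Finset.sum_congr rfl fun b hb => ?_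
    have hab : a ≠ b := fun h => ha (h ▸ hb)
    rw [Finset.erase_insert_of_ne hab, Finset.prod_insert fun h => ha (Finset.mem_of_mem_erase h),
      mul_assoc]

lemma pow (hp : HasCoeffDeriv p p') (e : ℕ) :
    HasCoeffDeriv (fun t => p t ^ (e + 1)) (((e + 1 : ℕ) : ℝ[X]) * p 0 ^ e * p') := by
  induction e with
  | zero => simpa using hp
  | succ e ih =>
    simp only [pow_succ _ (e + 1)]
    convert ih.mul hp using 1
    push_cast
    ring

lemma exists_pow (hp : HasCoeffDeriv p p') (e : ℕ) : ∃ r, HasCoeffDeriv (fun t => p t ^ e) r := by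
  cases e with
  | zero => exact ⟨0, by simpa using const 1⟩
  | succ e => exact ⟨_, hp.pow e⟩

lemma exists_prod {α : Type*} {s : Finset α} {p : α → ℝ → ℝ[X]}
    (h : ∀ a ∈ s, ∃ r, HasCoeffDeriv (p a) r) :
    ∃ r, HasCoeffDeriv (fun t => ∏ a ∈ s, p a t) r := by
  choose! r hr using h
  exact ⟨_, prod hr⟩

lemma derivative (hp : HasCoeffDeriv p p') :
    HasCoeffDeriv (fun t => derivative (p t)) (derivative p') := fun j => by
  simp only [coeff_derivative]
  exact (hp (j + 1)).mul_const _

end HasCoeffDeriv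

end CoefficientCalculus

section Smoothness

open scoped ContDiff

variable {n : ℕ} {ι : Type*} [Fintype ι] {d : ι → Fin n → ℕ}

lemma coeffSmooth_polyFamily (i : ι) (m : Fin n) : CoeffSmooth fun x => polyFamily d x i m := by
  refine (CoeffSmooth.const _).add (CoeffSmooth.sum fun j _ => CoeffSmooth.mul (fun e => ?_)
    (CoeffSmooth.const _))
  simp only [coeff_C]
  split_ifs
  · exact contDiff_apply ℝ ℝ _
  · exact contDiff_const

lemma coeffSmooth_fullProd (i : ι) : CoeffSmooth fun x => fullProd (polyFamily d x i) :=
  CoeffSmooth.prod fun m _ => (coeffSmooth_polyFamily i m).pow _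

lemma coeffSmooth_critProd (i : ι) : CoeffSmooth fun x => critProd (polyFamily d x i) :=
  CoeffSmooth.prod fun m _ => (coeffSmooth_polyFamily i m).pow _

lemma coeffSmooth_critDefect (i : ι) : CoeffSmooth fun x => critDefect d x i :=
  (CoeffSmooth.sum fun m _ => (CoeffSmooth.const _).mul ((coeffSmooth_polyFamily i m).derivative.mul
    (CoeffSmooth.prod fun m' _ => coeffSmooth_polyFamily i m'))).sub
    ((CoeffSmooth.const _).mul (CoeffSmooth.prod fun j _ => coeffSmooth_critProd j))

lemma contDiff_ramMap (i₀ : ι) : ContDiff ℝ ∞ (ramMap d i₀) := by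
  refine contDiff_pi.2 fun s => ?_
  simp only [ramMap]
  split_ifs
  · exact coeffSmooth_critDefect _ _
  · exact coeffSmooth_fullProd _ _
  · exact ((coeffSmooth_fullProd _).sub (coeffSmooth_fullProd _)) _

lemma IsRamData.tendsto_cocompact_ramMap (hd : IsRamData d) (i₀ : ι) :
    Filter.Tendsto (ramMap d i₀) (Filter.cocompact _) (Filter.cocompact _) := by
  refine tendsto_cocompact_of_quasiHomogeneous (contDiff_ramMap i₀).continuous
    (fun s => d s.1 s.2.1 - s.2.2) (ramWeight d i₀) (fun s => ?_) (fun s => ?_)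
    (fun t x s ht => hd.ramMap_ramScale i₀ ht x s) fun x => hd.eq_zero_of_ramMap_eq_zero i₀
  · have := s.2.2.2
    omega
  · have := hd.ne_zero
    rw [ramWeight]
    split_ifs <;> omega

/-- The variation of the family of polynomials in the direction `v`. -/
noncomputable def polyVariation (d : ι → Fin n → ℕ) (v : RamIdx d → ℝ) (i : ι) (m : Fin n) : ℝ[X] :=
  ∑ j : Fin (d i m), C (v ⟨i, m, j⟩) * X ^ (j : ℕ)

lemma hasCoeffDeriv_polyFamily (x v : RamIdx d → ℝ) (i : ι) (m : Fin n) :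
    HasCoeffDeriv (fun t => polyFamily d (x + t • v) i m) (polyVariation d v i m) := by
  have h : ∀ t : ℝ, polyFamily d (x + t • v) i m =
      polyFamily d x i m + C t * polyVariation d v i m := by
    intro t
    simp only [polyFamily, polyVariation, Pi.add_apply, Pi.smul_apply, smul_eq_mul, C_add, C_mul,
      add_mul, Finset.sum_add_distrib, Finset.mul_sum, mul_assoc, add_assoc]
  intro j
  simp only [h, coeff_add, coeff_C_mul]
  simpa using ((hasDerivAt_id (0 : ℝ)).mul_const ((polyVariation d v i m).coeff j)).const_add
    ((polyFamily d x i m).coeff j)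

lemma hasCoeffDeriv_fullProd (x v : RamIdx d → ℝ) (i : ι) :
    HasCoeffDeriv (fun t => fullProd (polyFamily d (x + t • v) i))
      (critProd (polyFamily d x i) * tangentPoly (polyFamily d x i) (polyVariation d v i)) := by
  have h := HasCoeffDeriv.prod (s := Finset.univ)
    (p := fun (m : Fin n) (t : ℝ) => polyFamily d (x + t • v) i m ^ ((m : ℕ) + 1))
    fun m _ => (hasCoeffDeriv_polyFamily x v i m).pow (m : ℕ)
  simp only [zero_smul, add_zero] at h
  rw [← sum_pow_variation]
  convert h using 1
  · simp only [fullProd]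
  · refine Finset.sum_congr rfl fun m _ => ?_
    congr!

lemma exists_hasCoeffDeriv_critProd (x v : RamIdx d → ℝ) (i : ι) :
    ∃ r, HasCoeffDeriv (fun t => critProd (polyFamily d (x + t • v) i)) r :=
  HasCoeffDeriv.exists_prod fun m _ => (hasCoeffDeriv_polyFamily x v i m).exists_pow m

lemma exists_hasCoeffDeriv_critDefect (x v : RamIdx d → ℝ) (i : ι) :
    ∃ r, HasCoeffDeriv (fun t => critDefect d (x + t • v) i) r := by
  choose r hr using exists_hasCoeffDeriv_critProd (d := d) x v
  obtain ⟨r', hr'⟩ := HasCoeffDeriv.exists_prod (s := Finset.univ.erase i)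
    (p := fun j t => critProd (polyFamily d (x + t • v) j)) fun j _ => ⟨_, hr j⟩
  have h : ∀ m : Fin n, ∃ r, HasCoeffDeriv (fun t => (((m : ℕ) + 1 : ℕ) : ℝ[X]) *
      (derivative (polyFamily d (x + t • v) i m) *
        ∏ m' ∈ Finset.univ.erase m, polyFamily d (x + t • v) i m')) r := by
    intro m
    obtain ⟨r', hr'⟩ := HasCoeffDeriv.exists_prod (s := Finset.univ.erase m)
      (p := fun m t => polyFamily d (x + t • v) i m)
      fun m' _ => ⟨_, hasCoeffDeriv_polyFamily x v i m'⟩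
    exact ⟨_, (HasCoeffDeriv.const _).mul
      ((hasCoeffDeriv_polyFamily x v i m).derivative.mul hr')⟩
  choose g hg using h
  exact ⟨_, (HasCoeffDeriv.sum fun m _ => hg m).sub ((HasCoeffDeriv.const _).mul hr')⟩

/-- The differential of `ramMap` at a zero of `critDefect`, in terms of polynomials. -/
lemma IsRamData.exists_fderiv_ramMap_eq (hd : IsRamData d) (i₀ : ι) {x : RamIdx d → ℝ}
    (hx : ∀ i, critDefect d x i = 0) (v : RamIdx d → ℝ) :
    ∃ (g : ι → ℝ[X]) (R : ℝ[X]),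
      (∀ i t, ∑ m, d i m ≤ t + 1 → (g i).coeff t = 0) ∧
      (∀ i, critProd (polyFamily d x i) * g i = derivative (critProd (polyFamily d x i) *
        tangentPoly (polyFamily d x i) (polyVariation d v i)) - R) ∧
      ∀ s : RamIdx d, fderiv ℝ (ramMap d i₀) x v s =
        if (finSigmaFinEquiv s.2 : ℕ) + 1 < ∑ m, d s.1 m then (g s.1).coeff (finSigmaFinEquiv s.2)
        else if s.1 = i₀ then (critProd (polyFamily d x i₀) *
          tangentPoly (polyFamily d x i₀) (polyVariation d v i₀)).coeff (n - 1)
        else (critProd (polyFamily d x s.1) *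
          tangentPoly (polyFamily d x s.1) (polyVariation d v s.1) -
          critProd (polyFamily d x i₀) *
          tangentPoly (polyFamily d x i₀) (polyVariation d v i₀)).coeff 0 := by
  choose g hg using exists_hasCoeffDeriv_critDefect (d := d) x v
  choose c hc using exists_hasCoeffDeriv_critProd (d := d) x v
  obtain ⟨r, hr⟩ := HasCoeffDeriv.exists_prod (s := Finset.univ)
    (p := fun j t => critProd (polyFamily d (x + t • v) j)) fun j _ => ⟨_, hc j⟩
  refine ⟨g, C (n : ℝ) * r, fun i t ht => ?_, fun i => ?_, fun s => ?_⟩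
  rotate_left
  · have h1 := (hc i).mul (hg i)
    have h2 := (hasCoeffDeriv_fullProd x v i).derivative.sub
      ((HasCoeffDeriv.const (C (n : ℝ))).mul hr)
    simp only [critProd_mul_critDefect] at h1
    have h3 := h1.unique h2
    simp only [zero_smul, add_zero, hx i, mul_zero, zero_mul, zero_add] at h3
    exact h3
  · have hdiff : DifferentiableAt ℝ (ramMap d i₀) x :=
      (contDiff_ramMap i₀).contDiffAt.differentiableAt (by simp)
    have hline : HasDerivAt (fun t : ℝ => x + t • v) v 0 := by
      simpa using ((hasDerivAt_id (0 : ℝ)).smul_const v).const_add x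
    have h1 : HasDerivAt (fun t : ℝ => ramMap d i₀ (x + t • v)) (fderiv ℝ (ramMap d i₀) x v) 0 := by
      have h2 : HasFDerivAt (ramMap d i₀) (fderiv ℝ (ramMap d i₀) x) (x + (0 : ℝ) • v) := by
        simpa using hdiff.hasFDerivAt
      exact h2.comp_hasDerivAt 0 hline
    have h2 := (hasDerivAt_pi.1 h1) s
    refine h2.unique ?_
    simp only [ramMap]
    split_ifs
    · exact hg _ _
    · exact hasCoeffDeriv_fullProd x v _ _
    · exact ((hasCoeffDeriv_fullProd x v _).sub (hasCoeffDeriv_fullProd x v _)) _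
  · have h1 := hg i t
    simp only [hd.coeff_critDefect_eq_zero _ i ht] at h1
    exact h1.unique (hasDerivAt_const _ _)

end Smoothness

section LinearAlgebra

lemma LinearMap.det_eq_mul_det_of_intertwine {V W : Type*} [AddCommGroup V] [Module ℝ V]
    [FiniteDimensional ℝ V] [AddCommGroup W] [Module ℝ W] [FiniteDimensional ℝ W]
    {K : V →ₗ[ℝ] W} (hK : Function.Injective K) (hrank : Module.finrank ℝ V = Module.finrank ℝ W)
    {A T : V →ₗ[ℝ] V} {M : W →ₗ[ℝ] W} (h : K ∘ₗ A = M ∘ₗ K ∘ₗ T) :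
    LinearMap.det A = LinearMap.det M * LinearMap.det T := by
  have hA : A = (LinearEquiv.ofInjectiveOfFinrankEq K hK hrank).symm.toLinearMap ∘ₗ M ∘ₗ
      (LinearEquiv.ofInjectiveOfFinrankEq K hK hrank).toLinearMap ∘ₗ T := by
    rw [LinearEquiv.coe_ofInjectiveOfFinrankEq, ← h]
    refine LinearMap.ext fun v => ?_
    rw [LinearMap.comp_apply, LinearEquiv.coe_coe, LinearEquiv.eq_symm_apply,
      ← LinearEquiv.coe_coe, LinearEquiv.coe_ofInjectiveOfFinrankEq]
    rfl
  have hM := LinearMap.det_conj M (LinearEquiv.ofInjectiveOfFinrankEq K hK hrank).symm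
  rw [LinearEquiv.symm_symm] at hM
  rw [hA, ← hM, ← LinearMap.det_comp]
  rfl

lemma LinearMap.det_one_add_pos_of_sq_eq_zero {W : Type*} [AddCommGroup W] [Module ℝ W]
    {N : W →ₗ[ℝ] W} (h : N * N = 0) : 0 < LinearMap.det (1 + N) := by
  have h1 : 1 + N = (1 + (2⁻¹ : ℝ) • N) * (1 + (2⁻¹ : ℝ) • N) := by
    have h2 : N = (2⁻¹ : ℝ) • N + (2⁻¹ : ℝ) • N := by rw [← add_smul]; norm_num
    simp only [mul_add, add_mul, one_mul, mul_one, smul_mul_smul_comm, h, smul_zero, add_zero]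
    rw [add_assoc, ← h2]
  have h2 : (1 + N) * (1 - N) = 1 := by
    simp only [mul_sub, add_mul, one_mul, mul_one, h, add_zero]
    abel
  have h3 : LinearMap.det (1 + N) ≠ 0 := by
    intro h3
    have := congrArg LinearMap.det h2
    rw [map_mul, h3, zero_mul, map_one] at this
    exact zero_ne_one this
  refine lt_of_le_of_ne ?_ h3.symm
  rw [h1, map_mul]
  exact mul_self_nonneg _

end LinearAlgebra

section Jacobian

variable {n : ℕ} {ι : Type*} [Fintype ι] {d : ι → Fin n → ℕ}

/-- The polynomial with coefficients the coordinates of `c` in the `i`-th block. -/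
noncomputable def coordPoly (d : ι → Fin n → ℕ) (i : ι) : (RamIdx d → ℝ) →ₗ[ℝ] ℝ[X] :=
  ∑ s : Σ m, Fin (d i m), monomial (finSigmaFinEquiv s : ℕ) ∘ₗ LinearMap.proj ⟨i, s⟩

lemma coeff_coordPoly (i : ι) (c : RamIdx d → ℝ) (s : Σ m, Fin (d i m)) :
    (coordPoly d i c).coeff (finSigmaFinEquiv s) = c ⟨i, s⟩ := by
  simp only [coordPoly, LinearMap.sum_apply, LinearMap.comp_apply, LinearMap.proj_apply,
    finsetSum_coeff, coeff_monomial, Fin.val_inj, EmbeddingLike.apply_eq_iff_eq]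
  simp

lemma degree_coordPoly_lt (i : ι) (c : RamIdx d → ℝ) :
    (coordPoly d i c).degree < ((∑ m, d i m : ℕ) : WithBot ℕ) := by
  rw [coordPoly, LinearMap.sum_apply]
  refine (degree_sum_le _ _).trans_lt ((Finset.sup_lt_iff (WithBot.bot_lt_coe _)).2 fun s _ => ?_)
  exact (degree_monomial_le _ _).trans_lt (by exact_mod_cast (finSigmaFinEquiv s).2)

lemma coordPoly_eq {i : ι} {c : RamIdx d → ℝ} {p : ℝ[X]}
    (hp : p.degree < ((∑ m, d i m : ℕ) : WithBot ℕ))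
    (h : ∀ s, c ⟨i, s⟩ = p.coeff (finSigmaFinEquiv s)) : coordPoly d i c = p := by
  ext t
  rcases lt_or_ge t (∑ m, d i m) with ht | ht
  · obtain ⟨s, rfl⟩ := exists_finSigmaFinEquiv_eq ht
    rw [coeff_coordPoly, h]
  · rw [coeff_eq_zero_of_degree_lt, coeff_eq_zero_of_degree_lt]
    · exact hp.trans_le (by exact_mod_cast ht)
    · exact (degree_coordPoly_lt i c).trans_le (by exact_mod_cast ht)

/-- The matrix of the tangent map of `∏ Q_m`, in coordinates. -/
noncomputable def tangentMatrix {R : Type*} [CommRing R] (e : Fin n → ℕ) (Q : Fin n → R[X]) :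
    Matrix (Σ m, Fin (e m)) (Σ m, Fin (e m)) R :=
  Matrix.of fun s t => ((((t.1 : ℕ) + 1 : ℕ) : R[X]) *
    (X ^ (t.2 : ℕ) * ∏ m' ∈ Finset.univ.erase t.1, Q m')).coeff (finSigmaFinEquiv s)

/-- The block diagonal matrix with blocks the `tangentMatrix`es over the branch points. -/
noncomputable def ramTangent (d : ι → Fin n → ℕ) (x : RamIdx d → ℝ) :
    Matrix (RamIdx d) (RamIdx d) ℝ :=
  Matrix.blockDiagonal' fun i => tangentMatrix (d i) (polyFamily d x i)

lemma tangentPoly_polyVariation (x v : RamIdx d → ℝ) (i : ι) :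
    tangentPoly (polyFamily d x i) (polyVariation d v i) =
      ∑ t : Σ m, Fin (d i m), C (v ⟨i, t⟩) * ((((t.1 : ℕ) + 1 : ℕ) : ℝ[X]) *
        (X ^ (t.2 : ℕ) * ∏ m' ∈ Finset.univ.erase t.1, polyFamily d x i m')) := by
  rw [tangentPoly, Fintype.sum_sigma]
  refine Finset.sum_congr rfl fun m _ => ?_
  rw [polyVariation, Finset.sum_mul, Finset.mul_sum]
  exact Finset.sum_congr rfl fun j _ => by ring

lemma ramTangent_mulVec (x v : RamIdx d → ℝ) (i : ι) (s : Σ m, Fin (d i m)) :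
    (ramTangent d x).mulVec v ⟨i, s⟩ =
      (tangentPoly (polyFamily d x i) (polyVariation d v i)).coeff (finSigmaFinEquiv s) := by
  rw [tangentPoly_polyVariation, finsetSum_coeff, Matrix.mulVec, dotProduct, Fintype.sum_sigma,
    Finset.sum_eq_single i]
  · refine Finset.sum_congr rfl fun t _ => ?_
    rw [ramTangent, Matrix.blockDiagonal'_apply_eq, coeff_C_mul, tangentMatrix, Matrix.of_apply,
      mul_comm]
  · intro i' _ hi'
    refine Finset.sum_eq_zero fun t _ => ?_
    rw [ramTangent, Matrix.blockDiagonal'_apply_ne _ _ _ hi'.symm, zero_mul]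
  · simp

lemma degree_tangentPoly_polyVariation_lt (x v : RamIdx d → ℝ) (i : ι) :
    (tangentPoly (polyFamily d x i) (polyVariation d v i)).degree <
      ((∑ m, d i m : ℕ) : WithBot ℕ) := by
  have := degree_tangentPoly_lt (q := polyVariation d v i) (polyFamily_monic x i) fun m => by
    rw [degree_eq_natDegree (polyFamily_monic x i m).ne_zero, natDegree_polyFamily]
    exact degree_sum_C_mul_X_pow_lt _
  simpa only [natDegree_polyFamily] using this

lemma coordPoly_ramTangent (x v : RamIdx d → ℝ) (i : ι) :
    coordPoly d i ((ramTangent d x).mulVec v) =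
      tangentPoly (polyFamily d x i) (polyVariation d v i) :=
  coordPoly_eq (degree_tangentPoly_polyVariation_lt x v i) fun s => ramTangent_mulVec x v i s

namespace IsRamData

variable (hd : IsRamData d)
include hd

lemma degree_critProd_mul_lt (x : RamIdx d → ℝ) (i : ι) {p : ℝ[X]} {t : ℕ}
    (hp : p.degree < (t : WithBot ℕ)) :
    (critProd (polyFamily d x i) * p).degree <
      ((t + n - ∑ m, d i m : ℕ) : WithBot ℕ) := by
  have h2 := critProd_monic (polyFamily_monic x i)
  have h3 := hd.sum_add_sum_eq i
  rw [mul_comm, h2.degree_mul, degree_eq_natDegree h2.ne_zero,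
    natDegree_critProd (polyFamily_monic x i)]
  simp_rw [natDegree_polyFamily]
  have : t + n - ∑ m, d i m = t + ∑ m : Fin n, (m : ℕ) * d i m := by omega
  rw [this]
  by_cases h0 : p = 0
  · rw [h0, degree_zero, WithBot.bot_add]
    exact WithBot.bot_lt_coe _
  · rw [degree_eq_natDegree h0] at hp ⊢
    norm_cast at hp ⊢
    omega

lemma coeff_critProd_mul (x : RamIdx d → ℝ) (i : ι) {p : ℝ[X]}
    (hp : p.degree < ((∑ m, d i m : ℕ) : WithBot ℕ)) :
    (critProd (polyFamily d x i) * p).coeff (n - 1) = p.coeff (∑ m, d i m - 1) := by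
  have h2 := critProd_monic (polyFamily_monic x i)
  have h3 := hd.sum_add_sum_eq i
  have h4 := hd.sum_pos i
  have h5 := natDegree_critProd (polyFamily_monic x i)
  simp_rw [natDegree_polyFamily] at h5
  have h6 : n - 1 = (critProd (polyFamily d x i)).natDegree + (∑ m, d i m - 1) := by omega
  rw [h6, coeff_mul_add_eq_of_natDegree_le le_rfl, h2.coeff_natDegree, one_mul]
  rw [natDegree_le_iff_degree_le]
  rw [show ∑ m, d i m = (∑ m, d i m - 1) + 1 by omega] at hp
  exact Order.le_of_lt_succ (by exact_mod_cast hp)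

/-- Compares the components of a vector after multiplication by `critProd`. -/
noncomputable def compareMap (i₀ : ι) (x : RamIdx d → ℝ) :
    (RamIdx d → ℝ) →ₗ[ℝ] ({i // i ≠ i₀} → degreeLT ℝ n) × ℝ where
  toFun c := (fun i => ⟨critProd (polyFamily d x i) * coordPoly d i c -
      critProd (polyFamily d x i₀) * coordPoly d i₀ c, by
        have h : ∀ i, critProd (polyFamily d x i) * coordPoly d i c ∈ degreeLT ℝ n := fun i => by
          rw [mem_degreeLT]
          exact (hd.degree_critProd_mul_lt x i (degree_coordPoly_lt i c)).trans_le
            (by rw [Nat.add_sub_cancel_left])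
        exact (degreeLT ℝ n).sub_mem (h _) (h _)⟩, (coordPoly d i₀ c).coeff (∑ m, d i₀ m - 1))
  map_add' c c' := by
    ext1
    · funext i
      ext1
      simp only [map_add, Prod.fst_add, Pi.add_apply, Submodule.coe_add]
      ring
    · simp
  map_smul' r c := by
    ext1
    · funext i
      ext1
      simp [smul_sub]
    · simp

lemma compareMap_injective (i₀ : ι) {x : RamIdx d → ℝ}
    (hcop : Pairwise fun i j => IsCoprime (critProd (polyFamily d x i))
      (critProd (polyFamily d x j))) : Function.Injective (hd.compareMap i₀ x) := by
  refine (injective_iff_map_eq_zero _).2 fun c hc => ?_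
  have h1 : ∀ i, critProd (polyFamily d x i) * coordPoly d i c =
      critProd (polyFamily d x i₀) * coordPoly d i₀ c := by
    intro i
    by_cases hi : i = i₀
    · rw [hi]
    · exact sub_eq_zero.1 (congrArg Subtype.val (congrFun (congrArg Prod.fst hc) ⟨i, hi⟩))
  have h2 : (coordPoly d i₀ c).coeff (∑ m, d i₀ m - 1) = 0 := congrArg Prod.snd hc
  have h3 : ∏ i, critProd (polyFamily d x i) ∣ critProd (polyFamily d x i₀) * coordPoly d i₀ c :=
    Fintype.prod_dvd_of_coprime hcop fun i => ⟨_, (h1 i).symm⟩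
  have hpos := hd.sum_pos i₀
  have h4 : (coordPoly d i₀ c).degree < ((∑ m, d i₀ m - 1 : ℕ) : WithBot ℕ) := by
    rw [degree_lt_iff_coeff_zero]
    intro t ht
    rcases ht.eq_or_lt with rfl | ht
    · exact h2
    · exact coeff_eq_zero_of_degree_lt
        ((degree_coordPoly_lt i₀ c).trans_le (by exact_mod_cast (by omega)))
  have h5 := hd.degree_critProd_mul_lt x i₀ h4
  have hmon : (∏ i, critProd (polyFamily d x i)).Monic :=
    monic_prod_of_monic _ _ fun i _ => critProd_monic (polyFamily_monic x i)
  have h6 : critProd (polyFamily d x i₀) * coordPoly d i₀ c = 0 := by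
    refine eq_zero_of_dvd_of_degree_lt h3 (h5.trans_le ?_)
    rw [degree_eq_natDegree hmon.ne_zero, hd.natDegree_prod_critProd]
    exact_mod_cast (by omega)
  funext ⟨i, s⟩
  have h7 : coordPoly d i c = 0 :=
    (mul_eq_zero.1 ((h1 i).trans h6)).resolve_left (critProd_monic (polyFamily_monic x i)).ne_zero
  rw [← coeff_coordPoly i c s, h7, coeff_zero, Pi.zero_apply]

lemma finrank_eq (i₀ : ι) : Module.finrank ℝ (RamIdx d → ℝ) =
    Module.finrank ℝ (({i // i ≠ i₀} → degreeLT ℝ n) × ℝ) := by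
  have h1 : Module.finrank ℝ (degreeLT ℝ n) = n := by
    rw [(degreeLTEquiv ℝ n).finrank_eq, Module.finrank_fin_fun]
  have h2 : ∑ i, (∑ m, d i m + ∑ m : Fin n, (m : ℕ) * d i m) = Fintype.card ι * n := by
    simp_rw [hd.sum_add_sum_eq]
    simp
  have h3 := hd.crit
  rw [Finset.sum_add_distrib] at h2
  rw [Module.finrank_fintype_fun_eq_card, Module.finrank_prod, Module.finrank_pi_fintype,
    Module.finrank_self]
  simp only [h1, Finset.sum_const, Finset.card_univ, Fintype.card_subtype_compl, smul_eq_mul,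
    Fintype.card_sigma, Fintype.card_fin, Fintype.card_unique]
  have : 0 < Fintype.card ι := Fintype.card_pos_iff.2 ⟨i₀⟩
  obtain ⟨k, hk⟩ := Nat.exists_eq_succ_of_ne_zero this.ne'
  rw [hk] at h2 ⊢
  rw [Nat.succ_mul] at h2
  rw [Nat.succ_sub_one]
  omega

end IsRamData

/-- Differentiation, completed to an automorphism by an extra coordinate. -/
noncomputable def diffMap (κ : Type*) (hn : n ≠ 0) :
    ((κ → degreeLT ℝ n) × ℝ) →ₗ[ℝ] (κ → degreeLT ℝ n) × ℝ where
  toFun u := (fun i => ⟨derivative (u.1 i : ℝ[X]) +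
      C ((u.1 i : ℝ[X]).coeff 0 - u.2) * X ^ (n - 1), by
        refine (degreeLT ℝ n).add_mem (mem_degreeLT.2 ?_) (mem_degreeLT.2 ?_)
        · exact (degree_derivative_le).trans_lt (mem_degreeLT.1 (u.1 i).2)
        · exact (degree_C_mul_X_pow_le _ _).trans_lt (by exact_mod_cast (by omega))⟩, u.2)
  map_add' u u' := by
    ext1
    · funext i
      ext1
      simp only [Prod.fst_add, Prod.snd_add, Pi.add_apply, Submodule.coe_add, coeff_add,
        derivative_add, C_add, C_sub]
      ring
    · simp
  map_smul' r u := by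
    ext1
    · funext i
      ext1
      simp only [Prod.smul_fst, Prod.smul_snd, Pi.smul_apply, Submodule.coe_smul, coeff_smul,
        derivative_smul, smul_eq_mul, C_sub, C_mul, RingHom.id_apply]
      simp only [smul_eq_C_mul]
      ring
    · simp

lemma det_diffMap_ne_zero {κ : Type*} [Finite κ] (hn : n ≠ 0) :
    LinearMap.det (diffMap κ hn) ≠ 0 := by
  refine LinearMap.isUnit_iff_isUnit_det (diffMap κ hn) |>.1 ?_ |>.ne_zero
  refine (LinearMap.isUnit_iff_ker_eq_bot _).2 (LinearMap.ker_eq_bot'.2 fun u hu => ?_)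
  have h1 : u.2 = 0 := congrArg Prod.snd hu
  refine Prod.ext (funext fun i => Subtype.ext ?_) h1
  have h2 : derivative (u.1 i : ℝ[X]) + C ((u.1 i : ℝ[X]).coeff 0 - u.2) * X ^ (n - 1) = 0 :=
    congrArg Subtype.val (congrFun (congrArg Prod.fst hu) i)
  have h4 : (u.1 i : ℝ[X]).coeff n = 0 := coeff_eq_zero_of_degree_lt (mem_degreeLT.1 (u.1 i).2)
  have h3 : (u.1 i : ℝ[X]).coeff 0 = 0 := by
    have h3 := congrArg (fun p => p.coeff (n - 1)) h2
    simp only [coeff_add, coeff_derivative, coeff_C_mul, coeff_X_pow_self, coeff_zero, h1,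
      Nat.sub_add_cancel (Nat.pos_of_ne_zero hn), h4] at h3
    simpa using h3
  rw [h3, h1, sub_zero, C_0, zero_mul, add_zero] at h2
  rw [eq_C_of_natDegree_eq_zero (derivative_eq_zero.1 h2), h3, C_0]
  rfl

namespace IsRamData

variable (hd : IsRamData d)
include hd

lemma degree_critProd_mul_X_pow_sub_lt (x : RamIdx d → ℝ) (i : ι) :
    (critProd (polyFamily d x i) * X ^ (∑ m, d i m - 1) - X ^ (n - 1)).degree <
      ((n - 1 : ℕ) : WithBot ℕ) := by
  have h2 := critProd_monic (polyFamily_monic x i)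
  have h3 := hd.sum_add_sum_eq i
  have h4 := hd.sum_pos i
  have h5 := natDegree_critProd (polyFamily_monic x i)
  simp_rw [natDegree_polyFamily] at h5
  have h6 : (critProd (polyFamily d x i) * X ^ (∑ m, d i m - 1)).degree =
      ((n - 1 : ℕ) : WithBot ℕ) := by
    rw [(monic_X_pow _).degree_mul, degree_X_pow, degree_eq_natDegree h2.ne_zero, h5]
    exact_mod_cast (by omega)
  refine (degree_sub_lt_left ?_ (h2.mul (monic_X_pow _)).ne_zero ?_).trans_eq h6
  · rw [h6, degree_X_pow]
  · rw [(h2.mul (monic_X_pow _)).leadingCoeff, (monic_X_pow _).leadingCoeff]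

/-- The nilpotent correction relating the differential of `ramMap` to `diffMap`. -/
noncomputable def shearMap (i₀ : ι) (x : RamIdx d → ℝ) :
    (({i // i ≠ i₀} → degreeLT ℝ n) × ℝ) →ₗ[ℝ] ({i // i ≠ i₀} → degreeLT ℝ n) × ℝ where
  toFun u := (fun i => ⟨
      ((u.1 i : ℝ[X]).coeff (n - 1) + u.2) •
        (critProd (polyFamily d x i) * X ^ (∑ m, d i m - 1) - X ^ (n - 1)) -
      u.2 • (critProd (polyFamily d x i₀) * X ^ (∑ m, d i₀ m - 1) - X ^ (n - 1)), by
        have h : ∀ i, critProd (polyFamily d x i) * X ^ (∑ m, d i m - 1) - X ^ (n - 1) ∈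
            degreeLT ℝ n := fun i => mem_degreeLT.2
              ((hd.degree_critProd_mul_X_pow_sub_lt x i).trans_le (by exact_mod_cast Nat.sub_le _ _))
        exact (degreeLT ℝ n).sub_mem ((degreeLT ℝ n).smul_mem _ (h _))
          ((degreeLT ℝ n).smul_mem _ (h _))⟩, 0)
  map_add' u u' := by
    ext1
    · funext i
      ext1
      simp only [Prod.fst_add, Prod.snd_add, Pi.add_apply, Submodule.coe_add, coeff_add,
        smul_eq_C_mul, C_add]
      ring
    · simp
  map_smul' r u := by
    ext1
    · funext i
      ext1
      simp only [Prod.smul_fst, Prod.smul_snd, Pi.smul_apply, Submodule.coe_smul, coeff_smul,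
        smul_eq_mul, RingHom.id_apply]
      simp only [smul_eq_C_mul, C_add, C_mul]
      ring
    · simp

lemma shearMap_mul_self (i₀ : ι) (x : RamIdx d → ℝ) :
    hd.shearMap i₀ x * hd.shearMap i₀ x = 0 := by
  refine LinearMap.ext fun u => Prod.ext (funext fun i => Subtype.ext ?_) rfl
  change ((((u.1 i : ℝ[X]).coeff (n - 1) + u.2) •
        (critProd (polyFamily d x i) * X ^ (∑ m, d i m - 1) - X ^ (n - 1)) -
      u.2 • (critProd (polyFamily d x i₀) * X ^ (∑ m, d i₀ m - 1) - X ^ (n - 1))).coeff (n - 1)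
      + (0 : ℝ)) • (critProd (polyFamily d x i) * X ^ (∑ m, d i m - 1) - X ^ (n - 1)) -
      (0 : ℝ) • (critProd (polyFamily d x i₀) * X ^ (∑ m, d i₀ m - 1) - X ^ (n - 1)) = 0
  rw [coeff_sub, coeff_smul, coeff_smul,
    coeff_eq_zero_of_degree_lt (hd.degree_critProd_mul_X_pow_sub_lt x i),
    coeff_eq_zero_of_degree_lt (hd.degree_critProd_mul_X_pow_sub_lt x i₀)]
  simp

/-- The polynomials attached to the differential of `ramMap` applied to `v`. -/
lemma critProd_mul_coordPoly_fderiv (i₀ : ι) {x : RamIdx d → ℝ}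
    (hx : ∀ i, critDefect d x i = 0) (v : RamIdx d → ℝ) : ∃ R : ℝ[X],
      (coordPoly d i₀ (fderiv ℝ (ramMap d i₀) x v)).coeff (∑ m, d i₀ m - 1) =
        (critProd (polyFamily d x i₀) *
          tangentPoly (polyFamily d x i₀) (polyVariation d v i₀)).coeff (n - 1) ∧ ∀ i,
      critProd (polyFamily d x i) * coordPoly d i (fderiv ℝ (ramMap d i₀) x v) =
        derivative (critProd (polyFamily d x i) *
          tangentPoly (polyFamily d x i) (polyVariation d v i)) - R +
        C (if i = i₀ then (critProd (polyFamily d x i₀) *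
            tangentPoly (polyFamily d x i₀) (polyVariation d v i₀)).coeff (n - 1)
          else (critProd (polyFamily d x i) *
            tangentPoly (polyFamily d x i) (polyVariation d v i) -
            critProd (polyFamily d x i₀) *
            tangentPoly (polyFamily d x i₀) (polyVariation d v i₀)).coeff 0) *
        (critProd (polyFamily d x i) * X ^ (∑ m, d i m - 1)) := by
  obtain ⟨g, R, hg, hgR, hs⟩ := hd.exists_fderiv_ramMap_eq i₀ hx v
  refine ⟨R, ?_, fun i => ?_⟩
  · have hpos := hd.sum_pos i₀
    obtain ⟨s, h⟩ := exists_finSigmaFinEquiv_eq (d := d) (i := i₀) (t := ∑ m, d i₀ m - 1) (by omega)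
    rw [← h, coeff_coordPoly, hs]
    simp only
    rw [if_neg (by omega), if_pos trivial]
  rw [← hgR]
  generalize hα : (ite (i = i₀) _ _ : ℝ) = α
  have hpos := hd.sum_pos i
  have : coordPoly d i (fderiv ℝ (ramMap d i₀) x v) = g i + C α * X ^ (∑ m, d i m - 1) := by
    refine coordPoly_eq ?_ fun s => ?_
    · rw [degree_lt_iff_coeff_zero]
      intro t ht
      rw [coeff_add, hg i t (by omega), coeff_C_mul, coeff_X_pow, if_neg (by omega)]
      simp
    · have h1 := (finSigmaFinEquiv s).2
      rw [hs, coeff_add, coeff_C_mul, coeff_X_pow]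
      simp only
      rw [hα]
      split_ifs with h2 h3 h3
      · omega
      · simp
      · rw [hg i _ (by omega)]
        simp
      · omega
  rw [this]
  ring

lemma compareMap_comp_fderiv (i₀ : ι) {x : RamIdx d → ℝ} (hx : ∀ i, critDefect d x i = 0) :
    hd.compareMap i₀ x ∘ₗ (fderiv ℝ (ramMap d i₀) x : (RamIdx d → ℝ) →ₗ[ℝ] (RamIdx d → ℝ)) =
      ((1 + hd.shearMap i₀ x) * diffMap {i // i ≠ i₀} hd.ne_zero) ∘ₗ hd.compareMap i₀ x ∘ₗ
        Matrix.toLin' (ramTangent d x) := by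
  refine LinearMap.ext fun v => ?_
  obtain ⟨R, hR₀, hR⟩ := hd.critProd_mul_coordPoly_fderiv i₀ hx v
  have ha := fun i => degree_tangentPoly_polyVariation_lt x v i
  obtain ⟨a, ha'⟩ : ∃ a : ι → ℝ[X], ∀ i,
      tangentPoly (polyFamily d x i) (polyVariation d v i) = a i := ⟨_, fun _ => rfl⟩
  simp only [ha'] at hR₀ hR ha
  have hT : ∀ i, coordPoly d i (Matrix.toLin' (ramTangent d x) v) = a i := fun i => by
    rw [Matrix.toLin'_apply, coordPoly_ramTangent, ha']
  have hK : ∀ c i, ((hd.compareMap i₀ x c).1 i : ℝ[X]) =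
    critProd (polyFamily d x i) * coordPoly d i c -
      critProd (polyFamily d x i₀) * coordPoly d i₀ c := fun _ _ => rfl
  have hK2 : ∀ c, (hd.compareMap i₀ x c).2 = (coordPoly d i₀ c).coeff (∑ m, d i₀ m - 1) :=
    fun _ => rfl
  have hS : ∀ u (i : {i // i ≠ i₀}), ((diffMap {i // i ≠ i₀} hd.ne_zero u).1 i : ℝ[X]) =
    derivative (u.1 i : ℝ[X]) + C ((u.1 i : ℝ[X]).coeff 0 - u.2) * X ^ (n - 1) := fun _ _ => rfl
  have hS2 : ∀ u, (diffMap {i // i ≠ i₀} hd.ne_zero u).2 = u.2 := fun _ => rfl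
  have hN : ∀ u i, ((hd.shearMap i₀ x u).1 i : ℝ[X]) =
      ((u.1 i : ℝ[X]).coeff (n - 1) + u.2) •
        (critProd (polyFamily d x i) * X ^ (∑ m, d i m - 1) - X ^ (n - 1)) -
      u.2 • (critProd (polyFamily d x i₀) * X ^ (∑ m, d i₀ m - 1) - X ^ (n - 1)) :=
    fun _ _ => rfl
  have hN2 : ∀ u, (hd.shearMap i₀ x u).2 = 0 := fun _ => rfl
  have htop := hd.coeff_critProd_mul x i₀ (ha i₀)
  have hdeg : ∀ i, (critProd (polyFamily d x i) * a i).degree < (n : WithBot ℕ) := fun i =>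
    (hd.degree_critProd_mul_lt x i (ha i)).trans_le (by rw [Nat.add_sub_cancel_left])
  have hder : ∀ i, (derivative (critProd (polyFamily d x i) * a i)).coeff (n - 1) = 0 := by
    intro i
    rw [coeff_derivative, Nat.sub_add_cancel (Nat.pos_of_ne_zero hd.ne_zero),
      coeff_eq_zero_of_degree_lt (hdeg i), zero_mul]
  set K := hd.compareMap i₀ x
  set S := diffMap {i // i ≠ i₀} hd.ne_zero
  set N := hd.shearMap i₀ x
  change K (fderiv ℝ (ramMap d i₀) x v) = S (K (Matrix.toLin' (ramTangent d x) v)) +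
    N (S (K (Matrix.toLin' (ramTangent d x) v)))
  refine Prod.ext (funext fun i => Subtype.ext ?_) ?_
  · rw [Prod.fst_add, Pi.add_apply, Submodule.coe_add, hN, hS2, hS, hK, hK, hK2, hT, hT, hR i, hR i₀,
      if_pos rfl, if_neg i.2, coeff_add, ← htop]
    generalize (critProd (polyFamily d x i₀) * a i₀).coeff (n - 1) = τ
    have h1 : ∀ c, (C c * X ^ (n - 1) : ℝ[X]).coeff (n - 1) = c := fun c => by
      rw [coeff_C_mul, coeff_X_pow_self, mul_one]
    rw [h1, derivative_sub, coeff_sub, coeff_sub (derivative _), hder, hder]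
    simp only [smul_eq_C_mul, sub_zero, zero_add, sub_add_cancel, C_sub]
    ring
  · rw [Prod.snd_add, hN2, hS2, hK2, hK2, hR₀, hT, add_zero, htop]

lemma exists_det_fderiv_ramMap_eq (i₀ : ι) {x : RamIdx d → ℝ} (hx : ∀ i, critDefect d x i = 0)
    (hcop : Pairwise fun i j => IsCoprime (critProd (polyFamily d x i))
      (critProd (polyFamily d x j))) :
    ∃ c : ℝ, 0 < c ∧ (fderiv ℝ (ramMap d i₀) x).det =
      c * LinearMap.det (diffMap {i // i ≠ i₀} hd.ne_zero) * (ramTangent d x).det := by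
  refine ⟨_, LinearMap.det_one_add_pos_of_sq_eq_zero (hd.shearMap_mul_self i₀ x), ?_⟩
  rw [← map_mul, ← LinearMap.det_toLin']
  exact LinearMap.det_eq_mul_det_of_intertwine (hd.compareMap_injective i₀ hcop)
    (hd.finrank_eq i₀) (hd.compareMap_comp_fderiv i₀ hx)

end IsRamData

end Jacobian

section BlockDeterminant

lemma Matrix.det_blockDiagonal'_eq_prod {κ : Type*} [Fintype κ] [LinearOrder κ] {m : κ → Type*}
    [∀ i, Fintype (m i)] [∀ i, DecidableEq (m i)] {R : Type*} [CommRing R]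
    (M : ∀ i, Matrix (m i) (m i) R) : (Matrix.blockDiagonal' M).det = ∏ i, (M i).det := by
  rw [(Matrix.blockTriangular_blockDiagonal' M).det_fintype]
  refine Finset.prod_congr rfl fun i _ => ?_
  rw [← Matrix.det_submatrix_equiv_self (Equiv.sigmaSubtype i).symm]
  congr 1
  ext a b
  exact Matrix.blockDiagonal'_apply_eq M i a b

end BlockDeterminant

section TangentDeterminant

variable {n : ℕ}

lemma finSigmaFinEquiv_lt_iff {e : Fin n → ℕ} (s t : Σ m, Fin (e m)) :
    finSigmaFinEquiv s < finSigmaFinEquiv t ↔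
      s.1 < t.1 ∨ s.1 = t.1 ∧ (s.2 : ℕ) < t.2 := by
  have key : ∀ s t : Σ m, Fin (e m), s.1 < t.1 → finSigmaFinEquiv s < finSigmaFinEquiv t := by
    intro s t h
    have hv : ∀ u : Σ m, Fin (e m), (finSigmaFinEquiv u : ℕ) = ∑ i ∈ Finset.Iio u.1, e i + u.2 := by
      intro u
      rw [finSigmaFinEquiv_apply]
      congr 1
      refine Finset.sum_nbij (fun i => Fin.castLE u.1.2.le i) (fun i _ => ?_)
        (fun i _ j _ h => by simpa using h) (fun i hi => ?_) fun _ _ => rfl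
      · simp [Fin.lt_def]
      · rw [Finset.coe_Iio, Set.mem_Iio, Fin.lt_def] at hi
        exact ⟨⟨i, hi⟩, by simp, rfl⟩
    rw [Fin.lt_def, hv, hv]
    have h1 : insert s.1 (Finset.Iio s.1) ⊆ Finset.Iio t.1 := by
      intro i hi
      rcases Finset.mem_insert.1 hi with rfl | hi
      · exact Finset.mem_Iio.2 h
      · exact Finset.mem_Iio.2 ((Finset.mem_Iio.1 hi).trans h)
    have h2 := Finset.sum_le_sum_of_subset (f := e) h1
    rw [Finset.sum_insert (by simp)] at h2
    have := s.2.2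
    omega
  have key2 : ∀ m (j j' : Fin (e m)), finSigmaFinEquiv (⟨m, j⟩ : Σ m, Fin (e m)) <
      finSigmaFinEquiv ⟨m, j'⟩ ↔ (j : ℕ) < j' := by
    intro m j j'
    rw [Fin.lt_def, finSigmaFinEquiv_apply, finSigmaFinEquiv_apply]
    simp
  obtain ⟨m, j⟩ := s
  obtain ⟨m', j'⟩ := t
  rcases lt_trichotomy m m' with h | rfl | h
  · simp [key ⟨m, j⟩ ⟨m', j'⟩ h, h]
  · simp [key2]
  · have := key ⟨m', j'⟩ ⟨m, j⟩ h
    simp [this.le, h.ne', h.not_gt]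

lemma prod_Ioi_eq_prod_ite {κ M : Type*} [Fintype κ] [LinearOrder κ] [LocallyFiniteOrderTop κ]
    [CommMonoid M] (f : κ → κ → M) :
    ∏ a, ∏ b ∈ Finset.Ioi a, f a b = ∏ a, ∏ b, if a < b then f a b else 1 := by
  refine Finset.prod_congr rfl fun a _ => ?_
  rw [← Finset.prod_filter]
  refine Finset.prod_congr ?_ fun _ _ => rfl
  ext b
  simp

lemma prod_sigma_Ioi {e : Fin n → ℕ} {M : Type*} [CommMonoid M]
    (f : (Σ m, Fin (e m)) → (Σ m, Fin (e m)) → M) :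
    ∏ a, ∏ b ∈ Finset.Ioi a, f (finSigmaFinEquiv.symm a) (finSigmaFinEquiv.symm b) =
      (∏ m, ∏ j, ∏ j' ∈ Finset.Ioi j, f ⟨m, j⟩ ⟨m, j'⟩) *
        ∏ m, ∏ m' ∈ Finset.Ioi m, ∏ j, ∏ j', f ⟨m, j⟩ ⟨m', j'⟩ := by
  rw [prod_Ioi_eq_prod_ite]
  have h1 : ∏ a, ∏ b, (if a < b then f (finSigmaFinEquiv.symm a) (finSigmaFinEquiv.symm b) else 1) =
      ∏ s : Σ m, Fin (e m), ∏ t : Σ m, Fin (e m),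
        if finSigmaFinEquiv s < finSigmaFinEquiv t then f s t else 1 := by
    rw [← Equiv.prod_comp finSigmaFinEquiv]
    refine Finset.prod_congr rfl fun s _ => ?_
    rw [← Equiv.prod_comp finSigmaFinEquiv]
    simp only [Equiv.symm_apply_apply]
  rw [h1, Fintype.prod_sigma, ← Finset.prod_mul_distrib]
  refine Finset.prod_congr rfl fun m _ => ?_
  have h2 : ∀ j, ∏ t : Σ m, Fin (e m),
      (if finSigmaFinEquiv (⟨m, j⟩ : Σ m, Fin (e m)) < finSigmaFinEquiv t then f ⟨m, j⟩ t else 1) =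
      (∏ j' ∈ Finset.Ioi j, f ⟨m, j⟩ ⟨m, j'⟩) *
        ∏ m' ∈ Finset.Ioi m, ∏ j', f ⟨m, j⟩ ⟨m', j'⟩ := by
    intro j
    rw [Fintype.prod_sigma, ← Finset.mul_prod_erase _ _ (Finset.mem_univ m)]
    congr 1
    · rw [← Finset.prod_filter]
      refine Finset.prod_congr ?_ fun _ _ => rfl
      ext j'
      simp [finSigmaFinEquiv_lt_iff]
    · rw [← Finset.prod_subset (s₁ := Finset.Ioi m)]
      · refine Finset.prod_congr rfl fun m' hm' => Finset.prod_congr rfl fun j' _ => ?_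
        rw [if_pos]
        exact (finSigmaFinEquiv_lt_iff _ _).2 (Or.inl (Finset.mem_Ioi.1 hm'))
      · intro m' hm'
        exact Finset.mem_erase.2 ⟨(Finset.mem_Ioi.1 hm').ne', Finset.mem_univ _⟩
      · intro m' hm' hm''
        refine Finset.prod_eq_one fun j' _ => if_neg fun h => ?_
        rcases (finSigmaFinEquiv_lt_iff _ _).1 h with h | ⟨h, -⟩
        · exact hm'' (Finset.mem_Ioi.2 h)
        · exact (Finset.mem_erase.1 hm').1 h.symm
  simp_rw [h2]
  rw [Finset.prod_mul_distrib, Finset.prod_comm (s := Finset.univ) (t := Finset.Ioi m)]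

variable {K : Type*} [Field K]

lemma det_tangentMatrix {e : Fin n → ℕ} {z : (Σ m, Fin (e m)) → K} (hz : Function.Injective z) :
    (tangentMatrix e fun m => ∏ j, (X - C (z ⟨m, j⟩))).det =
      (∏ m : Fin n, (((m : ℕ) + 1 : ℕ) : K) ^ e m) *
        ∏ m, ∏ m' ∈ Finset.Ioi m, ∏ j, ∏ j', (z ⟨m, j⟩ - z ⟨m', j'⟩) := by
  set Q : Fin n → K[X] := fun m => ∏ j, (X - C (z ⟨m, j⟩)) with hQ
  set V : Matrix (Σ m, Fin (e m)) (Σ m, Fin (e m)) K :=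
    Matrix.of fun s t => z s ^ (finSigmaFinEquiv t : ℕ) with hV
  have hVdet : V.det = (∏ m, (Matrix.vandermonde fun j => z ⟨m, j⟩).det) *
      ∏ m, ∏ m' ∈ Finset.Ioi m, ∏ j, ∏ j', (z ⟨m', j'⟩ - z ⟨m, j⟩) := by
    have h1 : V.submatrix finSigmaFinEquiv.symm finSigmaFinEquiv.symm =
        Matrix.vandermonde (z ∘ finSigmaFinEquiv.symm) := by
      ext a b
      simp only [hV, Matrix.submatrix_apply, Matrix.of_apply, Equiv.apply_symm_apply,
        Matrix.vandermonde_apply, Function.comp]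
    rw [← Matrix.det_submatrix_equiv_self finSigmaFinEquiv.symm, h1, Matrix.det_vandermonde]
    simp_rw [Matrix.det_vandermonde]
    exact prod_sigma_Ioi fun s t => z t - z s
  have hV0 : V.det ≠ 0 := by
    rw [hVdet]
    refine mul_ne_zero ?_ ?_
    · refine Finset.prod_ne_zero_iff.2 fun m _ => Matrix.det_vandermonde_ne_zero_iff.2 ?_
      exact hz.comp sigma_mk_injective
    · refine Finset.prod_ne_zero_iff.2 fun m _ => Finset.prod_ne_zero_iff.2 fun m' hm' =>
        Finset.prod_ne_zero_iff.2 fun j _ => Finset.prod_ne_zero_iff.2 fun j' _ =>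
        sub_ne_zero.2 (hz.ne fun h => ?_)
      exact (Finset.mem_Ioi.1 hm').ne' (congrArg Sigma.fst h)
  have hprod : V * tangentMatrix e Q = Matrix.blockDiagonal' fun m : Fin n =>
      Matrix.of fun j j' : Fin (e m) =>
      ((((m : ℕ) + 1 : ℕ) : K) * ∏ m' ∈ Finset.univ.erase m, (Q m').eval (z ⟨m, j⟩)) *
        Matrix.vandermonde (fun j => z ⟨m, j⟩) j j' := by
    ext s t
    obtain ⟨m, j⟩ := s
    obtain ⟨m', j'⟩ := t
    set p : K[X] := (((m' : ℕ) + 1 : ℕ) : K[X]) *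
      (X ^ (j' : ℕ) * ∏ m'' ∈ Finset.univ.erase m', Q m'') with hp
    have hdeg : p.natDegree < ∑ m, e m := by
      have hQd : ∀ m, (Q m).natDegree ≤ e m := fun m => by
        rw [hQ]
        simp [natDegree_prod_of_monic _ _ fun j _ => monic_X_sub_C (z ⟨m, j⟩)]
      calc p.natDegree ≤ (X ^ (j' : ℕ) * ∏ m'' ∈ Finset.univ.erase m', Q m'').natDegree := by
            rw [hp, ← C_eq_natCast]
            exact natDegree_C_mul_le _ _
        _ ≤ j' + ∑ m'' ∈ Finset.univ.erase m', e m'' :=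
            natDegree_mul_le_of_le (natDegree_X_pow_le _)
              ((natDegree_prod_le _ _).trans (Finset.sum_le_sum fun m _ => hQd m))
        _ < e m' + ∑ m'' ∈ Finset.univ.erase m', e m'' := by
            have := j'.2
            omega
        _ = ∑ m, e m := Finset.add_sum_erase _ _ (Finset.mem_univ _)
    have heval : (V * tangentMatrix e Q) ⟨m, j⟩ ⟨m', j'⟩ = p.eval (z ⟨m, j⟩) := by
      rw [eval_eq_sum_range' hdeg, Finset.sum_range, ← Equiv.sum_comp finSigmaFinEquiv,
        Matrix.mul_apply]
      exact Finset.sum_congr rfl fun s _ => mul_comm _ _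
    have hzero : (Q m).eval (z ⟨m, j⟩) = 0 := by
      rw [hQ, eval_prod]
      exact Finset.prod_eq_zero (Finset.mem_univ j) (by simp)
    rw [heval, hp, eval_mul, eval_mul, eval_prod, eval_pow, eval_X, eval_natCast]
    rcases eq_or_ne m m' with rfl | h
    · rw [Matrix.blockDiagonal'_apply_eq]
      simp only [Matrix.of_apply, Matrix.vandermonde_apply]
      ring
    · rw [Matrix.blockDiagonal'_apply_ne _ _ _ h, Finset.prod_eq_zero
        (Finset.mem_erase.2 ⟨h, Finset.mem_univ m⟩) hzero]
      ring
  have hdet := congrArg Matrix.det hprod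
  rw [Matrix.det_mul, Matrix.det_blockDiagonal'_eq_prod] at hdet
  refine mul_left_cancel₀ hV0 (hdet.trans ?_)
  simp_rw [Matrix.det_mul_column, Finset.prod_mul_distrib]
  rw [hVdet]
  have h2 : ∏ m : Fin n, ∏ j, ∏ m' ∈ Finset.univ.erase m, (Q m').eval (z ⟨m, j⟩) =
      ∏ m : Fin n, ∏ m' ∈ Finset.Ioi m, ((∏ j, ∏ j', (z ⟨m', j'⟩ - z ⟨m, j⟩)) *
        ∏ j, ∏ j', (z ⟨m, j⟩ - z ⟨m', j'⟩)) := by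
    have h3 := Finset.prod_prod_Ioi_mul_eq_prod_prod_off_diag
      (fun m' m : Fin n => ∏ j, ∏ j', (z ⟨m, j⟩ - z ⟨m', j'⟩))
    refine Eq.trans (Finset.prod_congr rfl fun m _ => ?_) (h3.symm.trans ?_)
    · rw [Finset.prod_comm, Finset.compl_eq_univ_sdiff, Finset.sdiff_singleton_eq_erase]
      simp only [hQ, eval_prod, eval_sub, eval_X, eval_C]
    · refine Finset.prod_congr rfl fun m _ => Finset.prod_congr rfl fun m' _ => ?_
      rw [mul_comm]
      congr 1
      rw [Finset.prod_comm]
  rw [h2]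
  simp_rw [Finset.prod_mul_distrib]
  simp only [Finset.prod_const, Finset.card_univ, Fintype.card_fin]
  ring

end TangentDeterminant

section RootPairs

open ComplexConjugate

/-- The real pairs `x < y` with `x` in `S'` and `y` in `S`. -/
def realInversions (S S' : Set ℝ) : Set (ℝ × ℝ) := {p | p.1 < p.2 ∧ p.1 ∈ S' ∧ p.2 ∈ S}

lemma sub_eq_norm_mul_sign {x y : ℝ} (h : x ≠ y) :
    (y - x : ℂ) = (if y < x then -1 else 1) * ‖(y - x : ℂ)‖ := by
  rw [← Complex.ofReal_sub, Complex.norm_real, Real.norm_eq_abs]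
  rcases lt_or_gt_of_ne h with h | h
  · rw [if_neg h.not_gt, abs_of_pos (sub_pos.2 h), one_mul]
  · rw [if_pos h, abs_of_neg (sub_neg.2 h)]
    simp

lemma prod_prod_sub_eq {S S' : Finset ℂ} (hS : ∀ z ∈ S, conj z ∈ S) (hS' : ∀ z ∈ S', conj z ∈ S')
    (hd : Disjoint S S') :
    ∏ y ∈ S', ∏ x ∈ S, (y - x) =
      (-1) ^ Nat.card (realInversions {x : ℝ | (x : ℂ) ∈ S} {x : ℝ | (x : ℂ) ∈ S'}) *
        ((∏ y ∈ S', ∏ x ∈ S, ‖y - x‖ : ℝ) : ℂ) := by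
  set σ : ℂ × ℂ → ℂ := fun p => if (p.1.im = 0 ∧ p.2.im = 0) ∧ p.1.re < p.2.re then -1 else 1
    with hσ
  have hne : ∀ p ∈ S' ×ˢ S, p.1 - p.2 ≠ 0 := fun p hp h => by
    rw [Finset.mem_product] at hp
    exact Finset.disjoint_left.1 hd hp.2 (sub_eq_zero.1 h ▸ hp.1)
  have hσσ : ∀ p : ℂ × ℂ, σ p * σ p = 1 := fun p => by
    rw [hσ]
    dsimp only
    split_ifs <;> norm_num
  have hσc : ∀ p : ℂ × ℂ, σ (conj p.1, conj p.2) = σ p := fun p => by simp [hσ]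
  have key : ∏ p ∈ S' ×ˢ S, (σ p * ((p.1 - p.2) / ‖p.1 - p.2‖)) = 1 := by
    refine Finset.prod_involution (fun p _ => (conj p.1, conj p.2)) (fun p hp => ?_)
      (fun p hp h h' => h ?_) (fun p hp => ?_) fun p _ => by simp
    · dsimp only
      rw [hσc, ← map_sub, Complex.norm_conj]
      have h0 : (‖p.1 - p.2‖ : ℂ) ≠ 0 := by simpa using hne p hp
      rw [mul_mul_mul_comm, hσσ, one_mul, div_mul_div_comm, Complex.mul_conj,
        Complex.normSq_eq_norm_sq]
      push_cast
      rw [pow_two, div_self (mul_ne_zero h0 h0)]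
    · obtain ⟨x, hx⟩ := Complex.conj_eq_iff_real.1 (congrArg Prod.fst h')
      obtain ⟨y, hy⟩ := Complex.conj_eq_iff_real.1 (congrArg Prod.snd h')
      have h0 := hne p hp
      have hxy : y ≠ x := fun h => h0 (by rw [hx, hy, h, sub_self])
      have h1 : (‖p.1 - p.2‖ : ℂ) ≠ 0 := by simpa using hne p hp
      have h2 : σ p = if x < y then -1 else 1 := by simp [hσ, hx, hy]
      rw [← mul_div_assoc, div_eq_one_iff_eq h1, hx, hy]
      conv_lhs => rw [sub_eq_norm_mul_sign hxy]
      rw [← mul_assoc, ← h2, hσσ, one_mul]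
    · rw [Finset.mem_product] at hp ⊢
      exact ⟨hS' _ hp.1, hS _ hp.2⟩
  have hσprod : ∏ p ∈ S' ×ˢ S, σ p =
      (-1) ^ Nat.card (realInversions {x : ℝ | (x : ℂ) ∈ S} {x : ℝ | (x : ℂ) ∈ S'}) := by
    rw [Finset.prod_ite, Finset.prod_const, Finset.prod_const_one, mul_one,
      ← Set.ncard_coe_finset]
    congr 1
    rw [← Nat.card_coe_set_eq]
    refine Nat.card_congr (Equiv.symm ?_)
    refine Equiv.ofBijective (fun p => ⟨((p.1.1 : ℂ), (p.1.2 : ℂ)), ?_⟩) ⟨fun p q h => ?_, ?_⟩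
    · obtain ⟨p, h1, h2, h3⟩ := p
      simpa [h1] using And.intro h2 h3
    · have h1 := congrArg Subtype.val h
      simp only [Prod.mk.injEq, Complex.ofReal_inj] at h1
      exact Subtype.ext (Prod.ext h1.1 h1.2)
    · rintro ⟨p, hp⟩
      rw [Finset.mem_coe, Finset.mem_filter, Finset.mem_product] at hp
      obtain ⟨⟨h1, h2⟩, ⟨h3, h4⟩, h5⟩ := hp
      have e1 : ((p.1.re : ℝ) : ℂ) = p.1 := Complex.ext rfl (by simp [h3])
      have e2 : ((p.2.re : ℝ) : ℂ) = p.2 := Complex.ext rfl (by simp [h4])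
      refine ⟨⟨(p.1.re, p.2.re), h5, ?_, ?_⟩, Subtype.ext (Prod.ext e1 e2)⟩
      · simpa [e1] using h1
      · simpa [e2] using h2
  rw [Finset.prod_mul_distrib, hσprod, Finset.prod_div_distrib] at key
  have h0 : ∏ p ∈ S' ×ˢ S, (‖p.1 - p.2‖ : ℂ) ≠ 0 :=
    Finset.prod_ne_zero_iff.2 fun p hp => by simpa using hne p hp
  rw [← mul_div_assoc, div_eq_one_iff_eq h0] at key
  rw [← Finset.prod_product', ← Finset.prod_product']
  push_cast
  rw [← key, ← mul_assoc, ← mul_pow]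
  norm_num

end RootPairs

section RealTangentDeterminant

open ComplexConjugate

lemma exists_eq_prod_X_sub_C {K : Type*} [Field K] [IsAlgClosed K] {p : K[X]} (hp : p.Monic) {e : ℕ}
    (he : p.natDegree = e) : ∃ z : Fin e → K, p = ∏ j, (X - C (z j)) := by
  have h1 := (IsAlgClosed.splits p).eq_prod_roots_of_monic hp
  have h2 : p.roots.toList.length = e := by
    rw [Multiset.length_toList, ← he, ← (IsAlgClosed.splits p).natDegree_eq_card_roots]
  subst h2
  refine ⟨p.roots.toList.get, ?_⟩
  conv_lhs => rw [h1, ← Multiset.coe_toList p.roots]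
  rw [Multiset.map_coe, Multiset.prod_coe, ← List.prod_ofFn]
  congr 1
  exact (List.ofFn_getElem_eq_map _ _).symm

variable {n : ℕ} {e : Fin n → ℕ}

lemma map_tangentMatrix {R S : Type*} [CommRing R] [CommRing S] (f : R →+* S) (Q : Fin n → R[X]) :
    (tangentMatrix e Q).map f = tangentMatrix e fun m => (Q m).map f := by
  ext s t
  rw [Matrix.map_apply, tangentMatrix, tangentMatrix, Matrix.of_apply, Matrix.of_apply,
    ← coeff_map]
  simp [Polynomial.map_prod]

/-- The sign of the determinant of `tangentMatrix` for families of real polynomials. -/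
lemma exists_det_tangentMatrix_eq {Q : Fin n → ℝ[X]} (hmon : ∀ m, (Q m).Monic)
    (hdeg : ∀ m, (Q m).natDegree = e m) (hsep : (∏ m, Q m).Separable) :
    ∃ c : ℝ, 0 < c ∧ (tangentMatrix e Q).det = c * ∏ m, ∏ m' ∈ Finset.Ioi m,
      ((-1) ^ (e m * e m') *
        (-1) ^ Nat.card (realInversions {x | (Q m).eval x = 0} {x | (Q m').eval x = 0})) := by
  choose z hz using fun m => exists_eq_prod_X_sub_C ((hmon m).map (algebraMap ℝ ℂ))
    (e := e m) (by rw [natDegree_map, hdeg])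
  set y : (Σ m, Fin (e m)) → ℂ := fun s => z s.1 s.2 with hy
  have hinj : Function.Injective y := by
    rw [← separable_prod_X_sub_C_iff, Fintype.prod_sigma]
    have := hsep.map (f := algebraMap ℝ ℂ)
    rw [Polynomial.map_prod] at this
    simpa only [hz] using this
  set S : Fin n → Finset ℂ := fun m => Finset.univ.image (z m) with hS
  have hzinj : ∀ m, Function.Injective (z m) := fun m => hinj.comp sigma_mk_injective
  have hmem : ∀ m x, x ∈ S m ↔ aeval x (Q m) = 0 := fun m x => by
    rw [← eval_map_algebraMap, hz, eval_prod, Finset.prod_eq_zero_iff]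
    simp [hS, sub_eq_zero, eq_comm]
  have hconj : ∀ m, ∀ x ∈ S m, conj x ∈ S m := fun m x hx => by
    rw [hmem] at hx ⊢
    rw [aeval_conj, hx, map_zero]
  have hreal : ∀ m, {x : ℝ | (x : ℂ) ∈ S m} = {x | (Q m).eval x = 0} := fun m => by
    ext x
    rw [Set.mem_ofPred_eq, hmem, Set.mem_ofPred_eq]
    have : aeval (x : ℂ) (Q m) = (((Q m).eval x : ℝ) : ℂ) := by
      simpa using aeval_algebraMap_apply ℂ x (Q m)
    rw [this, Complex.ofReal_eq_zero]
  have hdisj : ∀ m m', m ≠ m' → Disjoint (S m) (S m') := fun m m' h => by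
    rw [Finset.disjoint_left]
    intro x hx hx'
    obtain ⟨j, -, hj⟩ := Finset.mem_image.1 hx
    obtain ⟨j', -, hj'⟩ := Finset.mem_image.1 hx'
    exact h (congrArg Sigma.fst (hinj (a₁ := ⟨m, j⟩) (a₂ := ⟨m', j'⟩) (hj.trans hj'.symm)))
  have hpair : ∀ m, ∀ m' ∈ Finset.Ioi m, ∏ j, ∏ j', (z m j - z m' j') =
      ((-1) ^ (e m * e m') *
        (-1) ^ Nat.card (realInversions {x | (Q m).eval x = 0} {x | (Q m').eval x = 0})) *
        ((∏ y ∈ S m', ∏ x ∈ S m, ‖y - x‖ : ℝ) : ℂ) := by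
    intro m m' hm
    have h1 := prod_prod_sub_eq (hconj m) (hconj m') (hdisj m m' (Finset.mem_Ioi.1 hm).ne)
    rw [hreal, hreal] at h1
    rw [mul_assoc, ← h1, hS, Finset.prod_image (hzinj m').injOn, Finset.prod_comm]
    simp_rw [Finset.prod_image (hzinj m).injOn]
    have h2 : ((-1 : ℂ)) ^ (e m * e m') = ∏ _j' : Fin (e m'), ∏ _j : Fin (e m), (-1) := by
      simp [pow_mul]
    rw [h2]
    simp_rw [← Finset.prod_mul_distrib]
    simp
  refine ⟨(∏ m : Fin n, (((m : ℕ) + 1 : ℕ) : ℝ) ^ e m) *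
    ∏ m, ∏ m' ∈ Finset.Ioi m, ∏ y ∈ S m', ∏ x ∈ S m, ‖y - x‖, ?_, ?_⟩
  · refine mul_pos (Finset.prod_pos fun m _ => by positivity) (Finset.prod_pos fun m _ =>
      Finset.prod_pos fun m' hm => Finset.prod_pos fun y hy => Finset.prod_pos fun x hx => ?_)
    refine norm_pos_iff.2 (sub_ne_zero.2 fun h => ?_)
    exact Finset.disjoint_left.1 (hdisj m m' (Finset.mem_Ioi.1 hm).ne) hx (h ▸ hy)
  · apply Complex.ofReal_injective
    have h1 := RingHom.map_det (algebraMap ℝ ℂ) (tangentMatrix e Q)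
    rw [RingHom.mapMatrix_apply, map_tangentMatrix] at h1
    simp_rw [hz] at h1
    rw [det_tangentMatrix (z := y) hinj] at h1
    refine h1.trans ?_
    rw [Finset.prod_congr rfl fun m _ => Finset.prod_congr rfl (hpair m)]
    push_cast
    simp_rw [Finset.prod_mul_distrib]
    ring

end RealTangentDeterminant

section Disorders

variable {n : ℕ} {ι : Type*} [Fintype ι]

lemma finite_realInversions {f g : ℝ[X]} (hf : f ≠ 0) (hg : g ≠ 0) :
    (realInversions {x | f.eval x = 0} {x | g.eval x = 0}).Finite :=
  ((finite_setOfPred_isRoot hg).prod (finite_setOfPred_isRoot hf)).subset fun _ hp => ⟨hp.2.1, hp.2.2⟩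

lemma card_disorders_eq {P : ℝ[X]} {w : ι → ℝ} (hw : Function.Injective w)
    {Q : ι → Fin n → ℝ[X]} (hQ : ∀ i, IsRamFactor P (w i) (Q i)) (hP : 0 < P.natDegree)
    (hcrit : ∀ x, (derivative P).eval x = 0 → ∃ i, P.eval x = w i) :
    Nat.card (disorders P) = ∑ i, ∑ m, ∑ m' ∈ Finset.Ioi m,
      Nat.card (realInversions {x | (Q i m).eval x = 0} {x | (Q i m').eval x = 0}) := by
  have hne : ∀ c : ℝ, P - C c ≠ 0 := fun c h => by
    have h1 := natDegree_sub_C (p := P) (a := c)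
    rw [h, natDegree_zero] at h1
    omega
  have hval : ∀ i m x, (Q i m).eval x = 0 → P.eval x = w i := fun i m x h => by
    have h1 := (rootMultiplicity_pos (hne (w i))).1 (by rw [((hQ i).eval_eq_zero_iff x m).1 h]; omega)
    simpa [sub_eq_zero] using h1
  have hroot : ∀ i x, P.eval x = w i → ∃ m, (Q i m).eval x = 0 := fun i x h => by
    have h1 : (P - C (w i)).eval x = 0 := by simp [h]
    rw [(hQ i).eq, fullProd, eval_prod, Finset.prod_eq_zero_iff] at h1
    obtain ⟨m, -, hm⟩ := h1
    exact ⟨m, by simpa using hm⟩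
  let N : ι × (Σ _ : Fin n, Fin n) → Set (ℝ × ℝ) := fun a =>
    realInversions {x | (Q a.1 a.2.1).eval x = 0} {x | (Q a.1 a.2.2).eval x = 0}
  let A : Finset (ι × (Σ _ : Fin n, Fin n)) :=
    Finset.univ ×ˢ (Finset.univ.sigma fun m => Finset.Ioi m)
  have hsum : ∑ i, ∑ m, ∑ m' ∈ Finset.Ioi m,
      Nat.card (realInversions {x | (Q i m).eval x = 0} {x | (Q i m').eval x = 0}) =
      ∑ a : A, Nat.card (N a) := by
    rw [Finset.sum_coe_sort A fun a => Nat.card (N a), Finset.sum_product]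
    simp_rw [Finset.sum_sigma]
    rfl
  have hfin : ∀ a, Finite (N a) := fun a =>
    (finite_realInversions ((hQ _).monic _).ne_zero ((hQ _).monic _).ne_zero).to_subtype
  rw [hsum, ← Nat.card_sigma]
  refine Nat.card_congr (Equiv.symm (Equiv.ofBijective
    (fun s : Σ a : A, N a => (⟨s.2.1, ?_⟩ : disorders P)) ⟨fun s t h => ?_, ?_⟩))
  · obtain ⟨⟨⟨i, m, m'⟩, hA⟩, ⟨x, y⟩, hlt, hx, hy⟩ := s
    have hmm : m < m' := by simpa [A] using hA
    refine ⟨hlt, (hval i m' x hx).trans (hval i m y hy).symm, ?_⟩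
    change (P - C (P.eval y)).rootMultiplicity y < (P - C (P.eval x)).rootMultiplicity x
    rw [hval i m' x hx, hval i m y hy, ((hQ i).eval_eq_zero_iff x m').1 hx,
      ((hQ i).eval_eq_zero_iff y m).1 hy]
    simpa using hmm
  · obtain ⟨⟨⟨i, m, m'⟩, hA⟩, ⟨x, y⟩, hlt, hx, hy⟩ := s
    obtain ⟨⟨⟨i₁, m₁, m₁'⟩, hA₁⟩, ⟨x₁, y₁⟩, hlt₁, hx₁, hy₁⟩ := t
    obtain ⟨rfl, rfl⟩ : x = x₁ ∧ y = y₁ := by simpa using h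
    obtain rfl : i = i₁ := hw ((hval i m y hy).symm.trans (hval i₁ m₁ y hy₁))
    have h1 := (((hQ i).eval_eq_zero_iff x m').1 hx).symm.trans
      (((hQ i).eval_eq_zero_iff x m₁').1 hx₁)
    have h2 := (((hQ i).eval_eq_zero_iff y m).1 hy).symm.trans
      (((hQ i).eval_eq_zero_iff y m₁).1 hy₁)
    obtain rfl : m' = m₁' := Fin.ext (by omega)
    obtain rfl : m = m₁ := Fin.ext (by omega)
    rfl
  · rintro ⟨⟨x, y⟩, hlt, hxy, hmul⟩
    have hy1 : 0 < (P - C (P.eval y)).rootMultiplicity y :=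
      (rootMultiplicity_pos (hne _)).2 (by simp)
    have hx2 : 1 < (P - C (P.eval x)).rootMultiplicity x := lt_of_le_of_lt hy1 hmul
    have h1 := ((one_lt_rootMultiplicity_iff_isRoot (hne _)).1 hx2).2
    obtain ⟨i, hi⟩ := hcrit x (by simpa using h1)
    obtain ⟨m', hm'⟩ := hroot i x hi
    obtain ⟨m, hm⟩ := hroot i y (hxy.symm.trans hi)
    have hmm : m < m' := by
      change (P - C (P.eval y)).rootMultiplicity y < (P - C (P.eval x)).rootMultiplicity x at hmul
      rw [← hxy, hi, ((hQ i).eval_eq_zero_iff x m').1 hm', ((hQ i).eval_eq_zero_iff y m).1 hm]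
        at hmul
      simpa using hmul
    exact ⟨⟨⟨⟨i, m, m'⟩, by simpa [A] using hmm⟩, ⟨(x, y), hlt, hm', hm⟩⟩, rfl⟩

end Disorders

section SignFormula

lemma sign_mul_eq_of_sq_eq_one {c D u : ℝ} (hc : 0 < c) (hu : u = 1 ∨ u = -1) :
    ((SignType.sign (c * D * u) : SignType) : ℝ) = ((SignType.sign D : SignType) : ℝ) * u := by
  rw [sign_mul, sign_mul, sign_pos hc, one_mul]
  rcases hu with rfl | rfl <;> simp

variable {n : ℕ} {ι : Type*} [Fintype ι] {d : ι → Fin n → ℕ}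

lemma det_ramTangent (x : RamIdx d → ℝ) :
    (ramTangent d x).det = ∏ i, (tangentMatrix (d i) (polyFamily d x i)).det := by
  let _ : LinearOrder ι := LinearOrder.lift' (Fintype.equivFin ι) (Fintype.equivFin ι).injective
  convert Matrix.det_blockDiagonal'_eq_prod fun i => tangentMatrix (d i) (polyFamily d x i)
  rw [ramTangent]
  congr!

/-- The constant relating `epsilonP` to the sign of the Jacobian of `ramMap`. -/
noncomputable def ramSign (d : ι → Fin n → ℕ) (i₀ : ι) (hn : n ≠ 0) : ℝ :=
  ((SignType.sign (LinearMap.det (diffMap {i // i ≠ i₀} hn)) : SignType) : ℝ) *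
    (-1) ^ ∑ i, ∑ m, ∑ m' ∈ Finset.Ioi m, d i m * d i m'

lemma ramSign_ne_zero (i₀ : ι) (hn : n ≠ 0) : ramSign d i₀ hn ≠ 0 := by
  refine mul_ne_zero ?_ (pow_ne_zero _ (by norm_num))
  rcases (det_diffMap_ne_zero (κ := {i // i ≠ i₀}) hn).lt_or_gt with h | h
  · simp [sign_neg h]
  · simp [sign_pos h]

namespace IsRamData

variable (hd : IsRamData d) {w : ι → ℝ}
include hd

lemma eval_ramPoly_of_derivative_eq_zero {i₀ : ι} {x : RamIdx d → ℝ}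
    (hx : ramMap d i₀ x = ramTarget d i₀ w) {t : ℝ}
    (ht : (derivative (ramPoly d i₀ w x)).eval t = 0) : ∃ i, (ramPoly d i₀ w x).eval t = w i := by
  rw [hd.derivative_ramPoly hx, eval_mul, eval_C, eval_prod,
    mul_eq_zero_iff_left (Nat.cast_ne_zero.2 hd.ne_zero), Finset.prod_eq_zero_iff] at ht
  obtain ⟨i, -, hi⟩ := ht
  refine ⟨i, ?_⟩
  have h1 := (hd.ramPoly_sub_C hx i).symm ▸ critProd_dvd_fullProd (polyFamily d x i)
  have h2 := eval_eq_zero_of_dvd_of_eval_eq_zero h1 hi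
  simpa [sub_eq_zero] using h2

lemma sign_det_fderiv_ramMap (hw : Function.Injective w) (i₀ : ι) {x : RamIdx d → ℝ}
    (hx : ramMap d i₀ x = ramTarget d i₀ w) :
    ((SignType.sign (fderiv ℝ (ramMap d i₀) x).det : SignType) : ℝ) =
      ramSign d i₀ hd.ne_zero * (epsilonP (ramPoly d i₀ w x) : ℝ) := by
  have hQ := hd.isRamFactor hw hx
  obtain ⟨c, hc, hdet⟩ := hd.exists_det_fderiv_ramMap_eq i₀ ((hd.ramMap_eq_iff i₀ w x).1 hx).1
    fun i j hij => isCoprime_critProd hw (hd.ramPoly_sub_C hx) hij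
  choose c' hc' hdet' using fun i => exists_det_tangentMatrix_eq (hQ i).monic
    (natDegree_polyFamily x i) (hQ i).sep
  have hcard := card_disorders_eq hw hQ
    (by rw [hd.natDegree_ramPoly]; exact Nat.pos_of_ne_zero hd.ne_zero)
    fun t => hd.eval_ramPoly_of_derivative_eq_zero hx
  have hprod : (fderiv ℝ (ramMap d i₀) x).det = (c * ∏ i, c' i) *
      LinearMap.det (diffMap {i // i ≠ i₀} hd.ne_zero) *
      ((-1) ^ (∑ i, ∑ m, ∑ m' ∈ Finset.Ioi m, d i m * d i m') *
        (-1) ^ Nat.card (disorders (ramPoly d i₀ w x))) := by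
    rw [hdet, det_ramTangent, hcard]
    simp_rw [hdet', Finset.prod_mul_distrib, ← Finset.prod_pow_eq_pow_sum]
    ring
  rw [hprod, sign_mul_eq_of_sq_eq_one (mul_pos hc (Finset.prod_pos fun i _ => hc' i)), ramSign,
    epsilonP]
  · push_cast
    ring
  · rw [← pow_add]
    exact neg_one_pow_eq_or ℝ _

lemma det_fderiv_ramMap_ne_zero (hw : Function.Injective w) (i₀ : ι) {x : RamIdx d → ℝ}
    (hx : ramMap d i₀ x = ramTarget d i₀ w) : (fderiv ℝ (ramMap d i₀) x).det ≠ 0 := by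
  intro h
  have h1 := hd.sign_det_fderiv_ramMap hw i₀ hx
  rw [h, sign_zero, SignType.coe_zero, eq_comm, mul_eq_zero_iff_left (ramSign_ne_zero i₀ _),
    epsilonP] at h1
  simp at h1

end IsRamData

end SignFormula

section Invariance

variable {n k : ℕ} {Λ : Fin k → Multiset ℕ}

/-- The number of parts equal to `m + 1`. -/
def partCount (Λ : Fin k → Multiset ℕ) (i : Fin k) (m : Fin n) : ℕ := (Λ i).count ((m : ℕ) + 1)

lemma sum_partCount_smul (hΛ : ∀ i, IsPartitionOf n (Λ i)) (i : Fin k) (g : ℕ → ℕ) :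
    ∑ m : Fin n, partCount Λ i m * g (m + 1) = ((Λ i).map g).sum := by
  have hsub : (Λ i).toFinset ⊆ Finset.univ.image fun m : Fin n => (m : ℕ) + 1 := by
    intro a ha
    rw [Multiset.mem_toFinset] at ha
    have h1 : a ≤ n := (hΛ i).1 ▸ Multiset.le_sum_of_mem ha
    have h2 : a ≠ 0 := fun h => (hΛ i).2 (h ▸ ha)
    exact Finset.mem_image.2 ⟨⟨a - 1, by omega⟩, Finset.mem_univ _, by dsimp only; omega⟩
  rw [Finset.sum_multiset_map_count, Finset.sum_subset hsub, Finset.sum_image]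
  · rfl
  · intro a _ b _ h
    exact Fin.ext (by simpa using h)
  · intro a _ ha
    rw [Multiset.mem_toFinset] at ha
    rw [Multiset.count_eq_zero_of_notMem ha, zero_smul]

lemma isRamData_partCount (hn : 0 < n) (hΛ : ∀ i, IsPartitionOf n (Λ i))
    (hsum : ∑ i, (n - Multiset.card (Λ i)) = n - 1) :
    IsRamData (partCount Λ : Fin k → Fin n → ℕ) := by
  have h1 : ∀ i, ∑ m : Fin n, ((m : ℕ) + 1) * partCount Λ i m = n := fun i => by
    have h := sum_partCount_smul hΛ i id
    rw [Multiset.map_id, (hΛ i).1] at h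
    exact (Finset.sum_congr rfl fun m _ => mul_comm _ _).trans h
  refine ⟨h1, ?_⟩
  have h2 : ∀ i, ∑ m : Fin n, (m : ℕ) * partCount Λ i m = n - Multiset.card (Λ i) := fun i => by
    have h := sum_partCount_smul hΛ i fun _ => 1
    rw [Multiset.map_const', Multiset.sum_replicate, smul_eq_mul, mul_one] at h
    have h3 := h1 i
    simp_rw [add_mul, one_mul, Finset.sum_add_distrib] at h3
    simp_rw [mul_one] at h
    omega
  simp_rw [h2, hsum]
  omega

lemma ramSign_mul_finsum_epsilonP (hn : 1 < n) (hΛ : ∀ i, IsPartitionOf n (Λ i))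
    (hd : IsRamData (partCount Λ : Fin k → Fin n → ℕ)) (i₀ : Fin k) {w : Fin k → ℝ}
    (hw : Function.Injective w) :
    ramSign (partCount Λ) i₀ hd.ne_zero * ((∑ᶠ P ∈ sSet n Λ w, epsilonP P : ℤ) : ℝ) =
      ∑ᶠ x ∈ ramMap (partCount Λ) i₀ ⁻¹' {ramTarget (partCount Λ) i₀ w},
        ((SignType.sign (fderiv ℝ (ramMap (partCount Λ : Fin k → Fin n → ℕ) i₀) x).det :
          SignType) : ℝ) := by
  have hbij := bijOn_ramPoly hΛ hd (fun _ _ => rfl) hn hw i₀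
  have hfin := finite_preimage_of_regular (contDiff_ramMap i₀) (hd.tendsto_cocompact_ramMap i₀)
    (ramTarget (partCount Λ) i₀ w) fun x => hd.det_fderiv_ramMap_ne_zero hw i₀
  rw [← finsum_mem_eq_of_bijOn _ hbij fun x _ => rfl]
  have h := ((AddMonoidHom.mulLeft (ramSign (partCount Λ : Fin k → Fin n → ℕ) i₀
    hd.ne_zero)).comp (Int.castAddHom ℝ)).map_finsum_mem
    (fun x => epsilonP (ramPoly (partCount Λ) i₀ w x)) hfin
  refine h.trans (finsum_mem_congr rfl fun x hx => ?_)
  exact (hd.sign_det_fderiv_ramMap hw i₀ hx).symm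

/-- The s-number does not depend on the (distinct) branch points. -/
lemma finsum_epsilonP_eq (hn : 1 < n) (hΛ : ∀ i, IsPartitionOf n (Λ i))
    (hsum : ∑ i, (n - Multiset.card (Λ i)) = n - 1) {w w' : Fin k → ℝ}
    (hw : Function.Injective w) (hw' : Function.Injective w') (i₀ : Fin k) :
    ∑ᶠ P ∈ sSet n Λ w, epsilonP P = ∑ᶠ P ∈ sSet n Λ w', epsilonP P := by
  have hd : IsRamData (partCount Λ : Fin k → Fin n → ℕ) :=
    isRamData_partCount (by omega) hΛ hsum
  have h := finsum_sign_det_eq (contDiff_ramMap i₀) (hd.tendsto_cocompact_ramMap i₀)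
    (ramTarget (partCount Λ) i₀ w) (ramTarget (partCount Λ) i₀ w')
    (fun x => hd.det_fderiv_ramMap_ne_zero hw i₀) fun x => hd.det_fderiv_ramMap_ne_zero hw' i₀
  rw [← ramSign_mul_finsum_epsilonP hn hΛ hd i₀ hw,
    ← ramSign_mul_finsum_epsilonP hn hΛ hd i₀ hw'] at h
  exact_mod_cast mul_left_cancel₀ (ramSign_ne_zero i₀ _) h

lemma sSet_comp_swap (w : Fin k → ℝ) (i j : Fin k) :
    sSet n (Λ ∘ Equiv.swap i j) w = sSet n Λ (w ∘ Equiv.swap i j) := by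
  ext P
  refine and_congr_right fun _ => (Equiv.swap i j).forall_congr fun {a} => ?_
  simp

end Invariance

/-- Transposing the partitions assigned to two consecutive branch points `w i < w j`
(`j = i + 1`) does not change the s-number. -/
theorem transposition_invariance (n k : ℕ) (hk : 0 < k) (hkn : k < n)
    (Λ : Fin k → Multiset ℕ) (hΛ : ∀ i, IsPartitionOf n (Λ i))
    (hsum : ∑ i, (n - Multiset.card (Λ i)) = n - 1)
    (w : Fin k → ℝ) (hw : StrictMono w)
    (i j : Fin k) (hij : (j : ℕ) = (i : ℕ) + 1) :
    ∑ᶠ P ∈ sSet n Λ w, epsilonP P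
      = ∑ᶠ P ∈ sSet n (Λ ∘ Equiv.swap i j) w, epsilonP P := by
  rw [sSet_comp_swap]
  exact finsum_epsilonP_eq (by omega) hΛ hsum hw.injective
    (hw.injective.comp (Equiv.swap i j).injective) ⟨0, hk⟩
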